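/- arXiv:2310.05247 — 8 statements merged into one kernel-verified Lean document; each statement's English description precedes it below -/
import Mathlib

section
/- Let A be a ring. Then the Gorenstein-projective derived category D_GP(A) has arbitrary (small) products. -/
open CategoryTheory CategoryTheory.Limits

universe u

variable (A : Type u) [Ring A]

/-- The category of cochain complexes of left `A`-modules. -/
abbrev Cplx := CochainComplex (ModuleCat.{u} A) ℤ

/-- A cochain complex is acyclic (exact) if all its cohomology vanishes. -/
def IsAcyclicComplex (X : Cplx A) : Prop := ∀ n : ℤ, X.ExactAt n

/-- The complex `Hom_A(G, X)` is acyclic. -/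
def HomFromAcyclic (G : ModuleCat.{u} A) (X : Cplx A) : Prop :=
  ∀ (n : ℤ) (f : G ⟶ X.X n), f ≫ X.d n (n + 1) = 0 →
    ∃ g : G ⟶ X.X (n - 1), g ≫ X.d (n - 1) n = f

/-- The complex `Hom_A(X, J)` is acyclic. -/
def HomToAcyclic (X : Cplx A) (J : ModuleCat.{u} A) : Prop :=
  ∀ (n : ℤ) (f : X.X n ⟶ J), X.d (n - 1) n ≫ f = 0 →
    ∃ g : X.X (n + 1) ⟶ J, X.d n (n + 1) ≫ g = f

/-- A Gorenstein-projective module. -/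
def IsGorensteinProjective (G : ModuleCat.{u} A) : Prop :=
  ∃ P : Cplx A, IsAcyclicComplex A P ∧ (∀ n : ℤ, Module.Projective A (P.X n)) ∧
    (∀ Q : ModuleCat.{u} A, Module.Projective A Q → HomToAcyclic A P Q) ∧
    Nonempty (G ≅ kernel (P.d 0 1))

/-- A Gorenstein-injective module. -/
def IsGorensteinInjective (J : ModuleCat.{u} A) : Prop :=
  ∃ I : Cplx A, IsAcyclicComplex A I ∧ (∀ n : ℤ, Module.Injective A (I.X n)) ∧
    (∀ E : ModuleCat.{u} A, Module.Injective A E → HomFromAcyclic A E I) ∧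
    Nonempty (J ≅ kernel (I.d 0 1))

/-- A complex `X` is GP-acyclic if `Hom_A(G,X)` is acyclic for every
Gorenstein-projective module `G`. -/
def GPAcyclic (X : Cplx A) : Prop :=
  ∀ G : ModuleCat.{u} A, IsGorensteinProjective A G → HomFromAcyclic A G X

/-- A complex `X` is GI-acyclic if `Hom_A(X,J)` is acyclic for every
Gorenstein-injective module `J`. -/
def GIAcyclic (X : Cplx A) : Prop :=
  ∀ J : ModuleCat.{u} A, IsGorensteinInjective A J → HomToAcyclic A X J

/-- A cochain complex is contractible if its identity is homotopic to zero. -/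
def Contractible (X : Cplx A) : Prop := Nonempty (Homotopy (𝟙 X) 0)

/-- A cochain complex is bounded below if `Xⁿ = 0` for all sufficiently small `n`. -/
def BoundedBelow (X : Cplx A) : Prop := ∃ a : ℤ, ∀ n < a, IsZero (X.X n)

/-- A cochain complex is bounded if `Xⁿ = 0` for all but finitely many `n`. -/
def BoundedComplex (X : Cplx A) : Prop :=
  ∃ a b : ℤ, ∀ n : ℤ, (n < a ∨ b < n) → IsZero (X.X n)

/-- `ProjDimLE n M` means that `M` has projective dimension at most `n`. -/
def ProjDimLE : ℕ → ModuleCat.{u} A → Prop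
  | 0 => fun M => Module.Projective A M
  | n + 1 => fun M => ∃ (K P : ModuleCat.{u} A) (i : K ⟶ P) (p : P ⟶ M),
      Module.Projective A P ∧ Function.Injective i ∧ Function.Surjective p ∧
      Function.Exact i p ∧ ProjDimLE n K

/-- The big finitistic projective dimension of `A` is finite. -/
def FPDFinite : Prop :=
  ∃ s : ℕ, ∀ M : ModuleCat.{u} A, (∃ n : ℕ, ProjDimLE A n M) → ProjDimLE A s M

/-- The homotopy category `K(A)` of cochain complexes of `A`-modules. -/
abbrev KCat := HomotopyCategory (ModuleCat.{u} A) (ComplexShape.up ℤ)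

/-- The class of morphisms of `K(A)` whose cone is GP-acyclic, i.e. the
morphisms inverted in the Verdier quotient `K(A)/K_gpac(A)`. -/
def gpW : MorphismProperty (KCat A) := fun X Y f =>
  ∃ g : X.as ⟶ Y.as, (HomotopyCategory.quotient _ _).map g = f ∧
    GPAcyclic A (CochainComplex.mappingCone g)

/-- The class of morphisms of `K(A)` whose cone is GI-acyclic, i.e. the
morphisms inverted in the Verdier quotient `K(A)/K_giac(A)`. -/
def giW : MorphismProperty (KCat A) := fun X Y f =>
  ∃ g : X.as ⟶ Y.as, (HomotopyCategory.quotient _ _).map g = f ∧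
    GIAcyclic A (CochainComplex.mappingCone g)

/-- The Gorenstein-projective derived category `D_GP(A)`, the Verdier quotient
`K(A)/K_gpac(A)`, realized as the localization of `K(A)` at the morphisms whose
cone is GP-acyclic. -/
noncomputable abbrev DGP := (gpW A).Localization

/-- The quotient functor `K(A) ⥤ D_GP(A)`. -/
noncomputable abbrev DGPQ : KCat A ⥤ DGP A := (gpW A).Q

/-- The Gorenstein-injective derived category `D_GI(A)`, the Verdier quotient
`K(A)/K_giac(A)`, realized as the localization of `K(A)` at the morphisms whose
cone is GI-acyclic. -/
noncomputable abbrev DGI := (giW A).Localization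

/-- The quotient functor `K(A) ⥤ D_GI(A)`. -/
noncomputable abbrev DGIQ : KCat A ⥤ DGI A := (giW A).Q

/-- shifts of Gorenstein-projective modules in the homotopy category -/
def gpS : ObjectProperty (KCat A) := fun X =>
  ∃ (G : ModuleCat.{u} A) (n : ℤ), IsGorensteinProjective A G ∧
    Nonempty (X ≅ (HomotopyCategory.singleFunctor (ModuleCat.{u} A) n).obj G)

instance gpS_shift : (gpS A).IsStableUnderShift ℤ where
  isStableUnderShiftBy a := ⟨by
    rintro X ⟨G, n, hG, ⟨e⟩⟩
    exact ⟨G, n - a, hG, ⟨(shiftFunctor (KCat A) a).mapIso e ≪≫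
      ((HomotopyCategory.singleFunctors (ModuleCat.{u} A)).shiftIso a (n - a) n (by lia)).app G⟩⟩⟩

open CochainComplex.HomComplex in
lemma quot_homOf_eq_zero_iff {K L : Cplx A} (z : Cocycle K L 0) :
    (HomotopyCategory.quotient _ _).map (Cocycle.homOf z) = 0 ↔ z ∈ coboundaries K L 0 := by
  rw [HomotopyCategory.quotient_map_eq_zero_iff, mem_coboundaries_iff z (-1) (by simp)]
  constructor
  · rintro ⟨h⟩
    obtain ⟨b, hb⟩ := Cochain.equivHomotopy _ _ h
    exact ⟨b, by simpa using hb.symm⟩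
  · rintro ⟨b, hb⟩
    exact ⟨(Cochain.equivHomotopy _ _).symm ⟨b, by simpa using hb.symm⟩⟩

open CochainComplex.HomComplex in
lemma gpS_orth_iff (X : Cplx A) :
    (gpS A).rightOrthogonal ((HomotopyCategory.quotient _ _).obj X) ↔ GPAcyclic A X := by
  constructor
  · intro h G hG n f hf
    have := h ((HomotopyCategory.quotient _ _).map (Cocycle.homOf
      (Cocycle.fromSingleMk f (add_zero n) (n + 1) rfl hf))) ⟨G, n, hG, ⟨Iso.refl _⟩⟩
    rw [quot_homOf_eq_zero_iff,
      Cocycle.fromSingleMk_mem_coboundaries_iff _ _ _ _ _ (n - 1) (by lia)] at this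
    exact this
  · rintro h Y f ⟨G, n, hG, ⟨e⟩⟩
    rw [← cancel_epi e.inv, comp_zero]
    obtain ⟨g, hg⟩ := (HomotopyCategory.quotient (ModuleCat.{u} A) (ComplexShape.up ℤ)).map_surjective
      (X := (CochainComplex.singleFunctor (ModuleCat.{u} A) n).obj G) (Y := X) (e.inv ≫ f)
    refine hg.symm.trans ?_
    obtain ⟨z, rfl⟩ : ∃ z, g = Cocycle.homOf z := ⟨Cocycle.ofHom g, by simp⟩
    obtain ⟨f, hf, rfl⟩ := Cocycle.fromSingleMk_surjective z n (add_zero n) (n + 1) rfl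
    refine (quot_homOf_eq_zero_iff A _).2 ?_
    rw [Cocycle.fromSingleMk_mem_coboundaries_iff _ _ _ _ _ (n - 1) (by lia)]
    exact h G hG n f hf

lemma gpW_eq : gpW A = (gpS A).rightOrthogonal.trW := by
  ext X Y f
  obtain ⟨X, rfl⟩ := HomotopyCategory.quotient_obj_surjective X
  obtain ⟨Y, rfl⟩ := HomotopyCategory.quotient_obj_surjective Y
  have key (g : X ⟶ Y) : (gpS A).rightOrthogonal.trW ((HomotopyCategory.quotient _ _).map g) ↔
      GPAcyclic A (CochainComplex.mappingCone g) := by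
    rw [← gpS_orth_iff]
    exact ObjectProperty.trW_iff_of_distinguished _ _
      (HomotopyCategory.mappingCone_triangleh_distinguished g)
  constructor
  · rintro ⟨g, rfl, hg⟩
    exact (key g).2 hg
  · intro h
    obtain ⟨g, rfl⟩ := (HomotopyCategory.quotient _ _).map_surjective f
    exact ⟨g, rfl, (key g).1 h⟩

/-- Localizations with calculus of fractions and products. -/
lemma loc_hasProducts {C D : Type*} [Category C] [Category D] (L : C ⥤ D)
    (W : MorphismProperty C) [L.IsLocalization W] [W.HasLeftCalculusOfFractions]
    [W.HasRightCalculusOfFractions] (J : Type*) [HasProductsOfShape J C]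
    [W.IsStableUnderProductsOfShape J] : HasProductsOfShape J D := by
  have := Localization.essSurj L W
  suffices h : ∀ X : J → C, HasProduct (fun j => L.obj (X j)) by
    refine ⟨fun F => ?_⟩
    have := h (fun j => L.objPreimage (F.obj ⟨j⟩))
    exact hasLimit_of_iso (F := Discrete.functor (fun j => L.obj (L.objPreimage (F.obj ⟨j⟩))))
      (Discrete.natIso (fun j => L.objObjPreimageIso (F.obj j)))
  intro X
  have hmap : ∀ {Y : J → C} (s : ∀ j, X j ⟶ Y j), (∀ j, W (s j)) → W (Limits.Pi.map s) := by
    intro Y s hs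
    exact MorphismProperty.limMap _ (fun j => hs j.1)
  have ex : ∀ (T : C) (f : ∀ j, L.obj T ⟶ L.obj (X j)),
      ∃ g : L.obj T ⟶ L.obj (∏ᶜ X), ∀ j, g ≫ L.map (Pi.π X j) = f j := by
    intro T f
    choose φ hφ using fun j => Localization.exists_leftFraction L W (f j)
    have hs := hmap (fun j => (φ j).s) (fun j => (φ j).hs)
    have := Localization.inverts L W _ hs
    refine ⟨L.map (Pi.lift fun j => (φ j).f) ≫ inv (L.map (Limits.Pi.map fun j => (φ j).s)), ?_⟩
    intro j
    have := Localization.inverts L W _ (φ j).hs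
    rw [← cancel_mono (L.map (φ j).s), hφ, MorphismProperty.LeftFraction.map_comp_map_s,
      Category.assoc, Category.assoc, ← L.map_comp, ← Limits.Pi.map_π (fun j => (φ j).s) j,
      L.map_comp, IsIso.inv_hom_id_assoc, ← L.map_comp, Pi.lift_π]
  have un : ∀ (T : C) (g h : L.obj T ⟶ L.obj (∏ᶜ X)),
      (∀ j, g ≫ L.map (Pi.π X j) = h ≫ L.map (Pi.π X j)) → g = h := by
    have un' : ∀ (T : C) (a b : T ⟶ ∏ᶜ X),
      (∀ j, L.map a ≫ L.map (Pi.π X j) = L.map b ≫ L.map (Pi.π X j)) → L.map a = L.map b := by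
      intro T a b H
      have H' : ∀ j, ∃ (Z : C) (s : X j ⟶ Z) (_ : W s), (a ≫ Pi.π X j) ≫ s = (b ≫ Pi.π X j) ≫ s := by
        intro j
        rw [← MorphismProperty.map_eq_iff_postcomp L W]
        simpa using H j
      choose Z s hs e using H'
      rw [MorphismProperty.map_eq_iff_postcomp L W]
      exact ⟨_, Limits.Pi.map s, hmap s hs, by
        apply Pi.hom_ext; intro j; simpa using e j⟩
    intro T g h H
    obtain ⟨φ, hφ⟩ := Localization.exists_rightFraction L W g
    have := Localization.inverts L W _ φ.hs
    obtain ⟨ψ, hψ⟩ := Localization.exists_rightFraction L W (L.map φ.s ≫ h)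
    have := Localization.inverts L W _ ψ.hs
    have e1 : L.map ψ.s ≫ L.map φ.s ≫ g = L.map (ψ.s ≫ φ.f) := by
      rw [hφ, MorphismProperty.RightFraction.map_s_comp_map, L.map_comp]
    have e2 : L.map ψ.s ≫ L.map φ.s ≫ h = L.map ψ.f := by
      rw [hψ, MorphismProperty.RightFraction.map_s_comp_map]
    rw [← cancel_epi (L.map φ.s), ← cancel_epi (L.map ψ.s), e1, e2]
    apply un'
    intro j
    rw [← e1, ← e2]
    simp only [Category.assoc, H]
  have ex' : ∀ (T : D) (f : ∀ j, T ⟶ L.obj (X j)),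
      ∃ g : T ⟶ L.obj (∏ᶜ X), ∀ j, g ≫ L.map (Pi.π X j) = f j := by
    intro T f
    obtain ⟨g, hg⟩ := ex _ (fun j => (L.objObjPreimageIso T).hom ≫ f j)
    exact ⟨(L.objObjPreimageIso T).inv ≫ g, fun j => by simp [hg]⟩
  choose l hl using ex'
  refine ⟨⟨⟨Fan.mk (L.obj (∏ᶜ X)) (fun j => L.map (Pi.π X j)), Fan.IsLimit.mk _
    (fun s => l s.pt s.proj) (fun s j => hl _ _ j) (fun s m hm => ?_)⟩⟩⟩
  rw [← cancel_epi (L.objObjPreimageIso s.pt).hom]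
  apply un
  intro j
  have := hm j
  dsimp at this
  simp [hl, this]

/-- products in the homotopy category -/
lemma K_hasProducts (J : Type u) : HasProductsOfShape J (KCat A) := by
  suffices h : ∀ X : J → Cplx A, HasProduct
      (fun j => (HomotopyCategory.quotient (ModuleCat.{u} A) (ComplexShape.up ℤ)).obj (X j)) by
    refine ⟨fun F => ?_⟩
    have := h (fun j => (F.obj ⟨j⟩).as)
    exact hasLimit_of_iso (F := Discrete.functor (fun j =>
      (HomotopyCategory.quotient (ModuleCat.{u} A) (ComplexShape.up ℤ)).obj (F.obj ⟨j⟩).as))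
      (Discrete.natIso (fun j => Iso.refl (F.obj j)))
  intro X
  let q := HomotopyCategory.quotient (ModuleCat.{u} A) (ComplexShape.up ℤ)
  have hl (n : ℤ) : IsLimit (Fan.mk ((∏ᶜ X).X n) (fun j => (Pi.π X j).f n)) :=
    isLimitFanMkObjOfIsLimit (HomologicalComplex.eval (ModuleCat.{u} A) (ComplexShape.up ℤ) n)
      X (fun j => Pi.π X j) (productIsProduct X)
  have un (T : Cplx A) (a b : T ⟶ ∏ᶜ X)
      (H : ∀ j, q.map (a ≫ Pi.π X j) = q.map (b ≫ Pi.π X j)) : q.map a = q.map b := by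
    have h (j : J) : Homotopy (a ≫ Pi.π X j) (b ≫ Pi.π X j) := HomotopyCategory.homotopyOfEq _ _ (H j)
    let k (m n : ℤ) : T.X m ⟶ (∏ᶜ X).X n := Fan.IsLimit.lift (hl n) (fun j => (h j).hom m n)
    have hk (m n : ℤ) (j : J) : k m n ≫ (Pi.π X j).f n = (h j).hom m n :=
      Fan.IsLimit.fac (hl n) _ j
    apply HomotopyCategory.eq_of_homotopy
    refine ⟨k, ?_, ?_⟩
    · intro i j hij
      apply Fan.IsLimit.hom_ext (hl j)
      intro t
      exact (hk i j t).trans (by simp [(h t).zero i j hij])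
    · intro i
      apply Fan.IsLimit.hom_ext (hl i)
      intro t
      have e := (h t).comm i
      simp only [HomologicalComplex.comp_f] at e
      change a.f i ≫ (Pi.π X t).f i = _ ≫ (Pi.π X t).f i
      rw [e, dNext_eq _ (show (ComplexShape.up ℤ).Rel i (i + 1) by simp),
        prevD_eq _ (show (ComplexShape.up ℤ).Rel (i - 1) i by simp),
        dNext_eq _ (show (ComplexShape.up ℤ).Rel i (i + 1) by simp),
        prevD_eq _ (show (ComplexShape.up ℤ).Rel (i - 1) i by simp)]
      simp only [Preadditive.add_comp, Category.assoc, hk, ← HomologicalComplex.Hom.comm]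
      rw [reassoc_of% hk]
  have ex (T : KCat A) (f : ∀ j, T ⟶ q.obj (X j)) :
      ∃ g : T ⟶ q.obj (∏ᶜ X), ∀ j, g ≫ q.map (Pi.π X j) = f j := by
    obtain ⟨T, rfl⟩ := HomotopyCategory.quotient_obj_surjective T
    choose f' hf using fun j => q.map_surjective (f j)
    exact ⟨q.map (Pi.lift f'), fun j => by rw [← hf, ← q.map_comp, Pi.lift_π]⟩
  choose l hl' using ex
  refine ⟨⟨⟨Fan.mk (q.obj (∏ᶜ X)) (fun j => q.map (Pi.π X j)), Fan.IsLimit.mk _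
    (fun s => l s.pt s.proj) (fun s j => hl' _ _ j) (fun s m hm => ?_)⟩⟩⟩
  have H : ∀ j, m ≫ q.map (Pi.π X j) = l s.pt s.proj ≫ q.map (Pi.π X j) :=
    fun j => (hm j).trans (hl' _ _ j).symm
  obtain ⟨T, hT⟩ := HomotopyCategory.quotient_obj_surjective s.pt
  revert H
  generalize l s.pt s.proj = m'
  clear hm
  dsimp at m
  revert m m'
  rw [← hT]
  intro m m' H
  obtain ⟨m, rfl⟩ := q.map_surjective m
  obtain ⟨m', rfl⟩ := q.map_surjective m'
  exact un _ _ _ (fun j => by simpa using H j)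

lemma orth_pi {C : Type*} [Category C] [HasZeroMorphisms C] (P : ObjectProperty C)
    {J : Type*} (X : J → C) [HasProduct X] (h : ∀ j, P.rightOrthogonal (X j)) :
    P.rightOrthogonal (∏ᶜ X) := by
  intro Y f hY
  apply Pi.hom_ext
  intro j
  rw [h j (f ≫ Pi.π X j) hY, zero_comp]

lemma stable (J : Type u) :
    (gpS A).rightOrthogonal.trW.IsStableUnderProductsOfShape J := by
  have := K_hasProducts A J
  refine MorphismProperty.IsStableUnderProductsOfShape.mk _ _ ?_
  intro X₁ X₂ _ _ f hf
  exact ObjectProperty.trW.mk _ (Pretriangulated.productTriangle_distinguished _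
      (fun j => (hf j).choose_spec.choose_spec.choose_spec.choose))
      (orth_pi _ _ (fun j => (hf j).choose_spec.choose_spec.choose_spec.choose_spec))

/-- The Gorenstein-projective derived category `D_GP(A)` has
arbitrary (small) products. -/
theorem DGP_hasProducts : HasProducts.{u} (DGP A) := by
  intro J
  have := K_hasProducts A J
  have := stable A J
  have : (DGPQ A).IsLocalization (gpS A).rightOrthogonal.trW := by
    rw [← gpW_eq]; infer_instance
  exact loc_hasProducts (DGPQ A) (gpS A).rightOrthogonal.trW J
end

section
/- Let A be a ring. Then the Gorenstein-injective derived category D_GI(A) has arbitrary (small) coproducts. -/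
open CategoryTheory CategoryTheory.Limits

universe u

variable (A : Type u) [Ring A]

section Aux

open CategoryTheory.Pretriangulated CochainComplex.HomComplex

lemma aux_loc_coprod {C D : Type*} [Category* C] [Category* D] (L : C ⥤ D)
    (W : MorphismProperty C) [L.IsLocalization W] [W.HasLeftCalculusOfFractions]
    [W.HasRightCalculusOfFractions] (J : Type*) [HasCoproductsOfShape J C]
    (hW : ∀ (X Y : J → C) (f : ∀ j, X j ⟶ Y j), (∀ j, W (f j)) → W (Limits.Sigma.map f)) :
    HasCoproductsOfShape J D := by
  have hess : L.EssSurj := Localization.essSurj L W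
  have key : ∀ X : J → C, HasCoproduct (fun j => L.obj (X j)) := by
    intro X
    have hex : ∀ (T : D) (f : ∀ j, L.obj (X j) ⟶ T),
        ∃ g : L.obj (∐ X) ⟶ T, ∀ j, L.map (Sigma.ι X j) ≫ g = f j := by
      intro T f
      let e := L.objObjPreimageIso T
      choose φ hφ using fun j => Localization.exists_rightFraction L W (f j ≫ e.inv)
      have hs := hW _ _ (fun j => (φ j).s) (fun j => (φ j).hs)
      have := Localization.inverts L W _ hs
      refine ⟨inv (L.map (Limits.Sigma.map fun j => (φ j).s)) ≫
        L.map (Limits.Sigma.desc fun j => (φ j).f) ≫ e.hom, fun j => ?_⟩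
      have := Localization.inverts L W _ (φ j).hs
      rw [← cancel_epi (L.map (φ j).s), ← cancel_mono e.inv]
      simp only [Category.assoc, hφ, MorphismProperty.RightFraction.map_s_comp_map, Iso.hom_inv_id,
        Category.comp_id]
      have h0 : (φ j).s ≫ Sigma.ι X j = Sigma.ι (fun j => (φ j).X') j ≫
          Limits.Sigma.map (fun j => (φ j).s) := by simp
      rw [← L.map_comp_assoc, h0, L.map_comp_assoc, IsIso.hom_inv_id_assoc,
        ← L.map_comp, Limits.Sigma.ι_desc]
    have huniq : ∀ (T : D) (g₁ g₂ : L.obj (∐ X) ⟶ T),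
        (∀ j, L.map (Sigma.ι X j) ≫ g₁ = L.map (Sigma.ι X j) ≫ g₂) → g₁ = g₂ := by
      intro T g₁ g₂ h
      let e := L.objObjPreimageIso T
      obtain ⟨φ, h₁, h₂⟩ := Localization.exists_leftFraction₂ L W (g₁ ≫ e.inv) (g₂ ≫ e.inv)
      have := Localization.inverts L W _ φ.hs
      have e₁ : g₁ ≫ e.inv ≫ L.map φ.s = L.map φ.f := by
        rw [← Category.assoc, h₁]; exact MorphismProperty.LeftFraction.map_comp_map_s φ.fst L _
      have e₂ : g₂ ≫ e.inv ≫ L.map φ.s = L.map φ.f' := by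
        rw [← Category.assoc, h₂]; exact MorphismProperty.LeftFraction.map_comp_map_s φ.snd L _
      rw [← cancel_mono (e.inv ≫ L.map φ.s), e₁, e₂]
      have h' : ∀ j, L.map (Sigma.ι X j ≫ φ.f) = L.map (Sigma.ι X j ≫ φ.f') := by
        intro j
        rw [L.map_comp, L.map_comp, ← e₁, ← e₂, reassoc_of% (h j)]
      choose Z s hs hsf using fun j => (MorphismProperty.map_eq_iff_precomp L W _ _).1 (h' j)
      rw [MorphismProperty.map_eq_iff_precomp L W]
      refine ⟨_, _, hW _ _ s hs, Limits.Sigma.hom_ext _ _ fun j => ?_⟩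
      simpa using hsf j
    choose d hd using hex
    exact ⟨⟨⟨Cofan.mk (L.obj (∐ X)) (fun j => L.map (Sigma.ι X j)),
      Cofan.IsColimit.mk _ (fun t => d _ t.inj) (fun t j => hd _ _ j)
        (fun t m hm => huniq _ _ _ fun j => (hm j).trans (hd _ _ j).symm)⟩⟩⟩
  constructor
  intro F
  have := key (fun j => L.objPreimage (F.obj ⟨j⟩))
  exact hasColimit_of_iso (F := Discrete.functor (fun j => L.obj (L.objPreimage (F.obj ⟨j⟩))))
    (Discrete.natIso (fun j => (L.objObjPreimageIso (F.obj j)).symm))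

lemma aux_trW {C : Type*} [Category* C] [HasZeroObject C] [HasShift C ℤ] [Preadditive C]
    [∀ (n : ℤ), (shiftFunctor C n).Additive] [Pretriangulated C]
    (S : ObjectProperty C) [S.IsStableUnderShift ℤ] :
    S.leftOrthogonal.trW = S.isLocal := by
  ext X Y f
  constructor
  · intro hf Z hZ
    have : S.leftOrthogonal.trW.isLocal Z := by
      rw [ObjectProperty.isLocal_trW]
      intro X f hX
      exact hX f hZ
    exact this f hf
  · intro hf
    obtain ⟨Z, g, h, hT⟩ := distinguished_cocone_triangle f
    refine ⟨Z, g, h, hT, ?_⟩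
    intro T a hTS
    have h1 : g ≫ a = 0 := (hf T hTS).1 (by
      have : f ≫ g = 0 := comp_distTriang_mor_zero₁₂ _ hT
      dsimp
      rw [reassoc_of% this]; simp)
    obtain ⟨b, hb⟩ : ∃ b : X⟦(1 : ℤ)⟧ ⟶ T, a = h ≫ b := Triangle.yoneda_exact₃ _ hT a h1
    obtain ⟨b', rfl⟩ := ((shiftEquiv C (1 : ℤ)).toAdjunction.homEquiv _ _).symm.surjective b
    obtain ⟨c, hc⟩ := (hf _ (S.le_shift (-1) _ hTS)).2 b'
    dsimp at hc
    have h31 : h ≫ f⟦(1 : ℤ)⟧' = 0 := comp_distTriang_mor_zero₃₁ _ hT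
    have h2 := (shiftEquiv C (1 : ℤ)).toAdjunction.homEquiv_naturality_left_symm f
      (show Y ⟶ (shiftEquiv C (1 : ℤ)).inverse.obj T from c)
    have h3 : ((shiftEquiv C (1 : ℤ)).toAdjunction.homEquiv X T).symm b' =
      f⟦(1 : ℤ)⟧' ≫ ((shiftEquiv C (1 : ℤ)).toAdjunction.homEquiv Y T).symm c := by
      rw [← hc]; exact h2
    rw [hb, h3]
    exact (Category.assoc _ _ _).symm.trans ((congrArg (· ≫ _) h31).trans zero_comp)

lemma aux_isLocal_sigma {C : Type*} [Category* C] (S : ObjectProperty C) (J : Type*)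
    [HasCoproductsOfShape J C] (X Y : J → C) (f : ∀ j, X j ⟶ Y j) (hf : ∀ j, S.isLocal (f j)) :
    S.isLocal (Limits.Sigma.map f) := by
  intro Z hZ
  constructor
  · intro a b hab
    refine Limits.Sigma.hom_ext _ _ fun j => (hf j Z hZ).1 ?_
    have := congr(Sigma.ι X j ≫ $hab)
    simpa using this
  · intro a
    choose b hb using fun j => (hf j Z hZ).2 (Sigma.ι X j ≫ a)
    refine ⟨Limits.Sigma.desc b, Limits.Sigma.hom_ext _ _ fun j => ?_⟩
    simpa using hb j

lemma aux_homotopy (J : Type u) (X : J → Cplx A) (Y : Cplx A) (f : (∐ X) ⟶ Y)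
    (h : ∀ j, Nonempty (Homotopy (Sigma.ι X j ≫ f) 0)) : Nonempty (Homotopy f 0) := by
  have hc : ∀ p : ℤ, IsColimit (Cofan.mk ((∐ X).X p) (fun j => (Sigma.ι X j).f p)) := fun p =>
    isColimitCofanMkObjOfIsColimit (HomologicalComplex.eval _ _ p) _ _
      (coproductIsCoproduct X)
  have hext : ∀ (p : ℤ) (T : ModuleCat.{u} A) (a b : (∐ X).X p ⟶ T),
      (∀ j, (Sigma.ι X j).f p ≫ a = (Sigma.ι X j).f p ≫ b) → a = b := fun p T a b hab =>
    Cofan.IsColimit.hom_ext (hc p) _ _ hab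
  have hex : ∀ j, ∃ z : Cochain (X j) Y (-1),
      Cochain.ofHom (Sigma.ι X j ≫ f) = δ (-1) 0 z + Cochain.ofHom 0 := fun j => by
    obtain ⟨β, hβ⟩ := Cochain.equivHomotopy _ _ (h j).some
    exact ⟨β, hβ⟩
  choose z hz using hex
  let Z : Cochain (∐ X) Y (-1) := Cochain.mk fun p q hpq =>
    Cofan.IsColimit.desc (hc p) (fun j => (z j).v p q hpq)
  have hZ : ∀ j p q hpq, (Sigma.ι X j).f p ≫ Z.v p q hpq = (z j).v p q hpq := fun j p q hpq =>
    Cofan.IsColimit.fac (hc p) _ j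
  refine ⟨(Cochain.equivHomotopy _ _).symm ⟨Z, ?_⟩⟩
  refine Cochain.ext₀ _ _ fun p => ?_
  refine hext _ _ _ _ fun j => ?_
  have := Cochain.congr_v (hz j) p p (by simp)
  simp [δ_v (-1) 0 rfl _ p p (by simp) (p-1) (p+1) rfl rfl] at this ⊢
  rw [this, ← hZ, ← hZ]
  simp

instance aux_K_coprod (J : Type u) : HasCoproductsOfShape J (KCat A) := by
  let Q := HomotopyCategory.quotient (ModuleCat.{u} A) (ComplexShape.up ℤ)
  have key : ∀ X : J → Cplx A, HasCoproduct (fun j => Q.obj (X j)) := by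
    intro X
    have hex : ∀ (T : KCat A) (f : ∀ j, Q.obj (X j) ⟶ T),
        ∃ g : Q.obj (∐ X) ⟶ T, ∀ j, Q.map (Sigma.ι X j) ≫ g = f j := by
      intro T f
      obtain ⟨T, rfl⟩ := HomotopyCategory.quotient_obj_surjective T
      choose f' hf' using fun j => Q.map_surjective (f j)
      refine ⟨Q.map (Limits.Sigma.desc f'), fun j => ?_⟩
      rw [← Q.map_comp, Limits.Sigma.ι_desc, hf']
    have huniq : ∀ (T : KCat A) (g₁ g₂ : Q.obj (∐ X) ⟶ T),
        (∀ j, Q.map (Sigma.ι X j) ≫ g₁ = Q.map (Sigma.ι X j) ≫ g₂) → g₁ = g₂ := by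
      intro T g₁ g₂ h
      obtain ⟨T, rfl⟩ := HomotopyCategory.quotient_obj_surjective T
      obtain ⟨g₁, rfl⟩ := Q.map_surjective g₁
      obtain ⟨g₂, rfl⟩ := Q.map_surjective g₂
      rw [← sub_eq_zero, ← Q.map_sub]
      obtain ⟨H⟩ := aux_homotopy A J X T (g₁ - g₂) (fun j => ⟨HomotopyCategory.homotopyOfEq _ _ (by
        have := h j
        rw [← Q.map_comp, ← Q.map_comp] at this
        change Q.map _ = Q.map _
        rw [Preadditive.comp_sub, Q.map_sub, this, sub_self, Q.map_zero])⟩)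
      exact (HomotopyCategory.eq_of_homotopy _ _ H).trans (Q.map_zero _ _)
    choose d hd using hex
    exact ⟨⟨⟨Cofan.mk (Q.obj (∐ X)) (fun j => Q.map (Sigma.ι X j)),
      Cofan.IsColimit.mk _ (fun t => d _ t.inj) (fun t j => hd _ _ j)
        (fun t m hm => huniq _ _ _ fun j => (hm j).trans (hd _ _ j).symm)⟩⟩⟩
  constructor
  intro F
  have := key (fun j => (F.obj ⟨j⟩).as)
  exact hasColimit_of_iso (F := Discrete.functor (fun j => Q.obj ((F.obj ⟨j⟩).as)))
    (Discrete.natIso (fun j => Iso.refl _))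

/-- Objects of `K(A)` isomorphic to shifts of Gorenstein-injective modules. -/
def auxS : ObjectProperty (KCat A) := fun Y => ∃ (n : ℤ) (J : ModuleCat.{u} A),
  IsGorensteinInjective A J ∧ Nonempty (Y ≅ (HomotopyCategory.singleFunctor _ n).obj J)

instance : (auxS A).IsStableUnderShift ℤ where
  isStableUnderShiftBy a := ⟨by
    rintro Y ⟨n, J, hJ, ⟨e⟩⟩
    exact ⟨n - a, J, hJ, ⟨(shiftFunctor _ a).mapIso e ≪≫
      ((HomotopyCategory.singleFunctors (ModuleCat.{u} A)).shiftIso a (n - a) n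
        (by lia)).app J⟩⟩⟩

lemma aux_giac (X : Cplx A) : GIAcyclic A X ↔
    (auxS A).leftOrthogonal ((HomotopyCategory.quotient _ _).obj X) := by
  let Q := HomotopyCategory.quotient (ModuleCat.{u} A) (ComplexShape.up ℤ)
  have key : ∀ (J : ModuleCat.{u} A) (n : ℤ)
      (φ : X ⟶ (CochainComplex.singleFunctor _ n).obj J) (f : X.X n ⟶ J) (hf : X.d (n-1) n ≫ f = 0),
      Cocycle.toSingleMk f (add_zero n) (n-1) (by lia) hf = Cocycle.ofHom φ →
      (Q.map φ = 0 ↔ ∃ g : X.X (n + 1) ⟶ J, X.d n (n + 1) ≫ g = f) := by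
    intro J n φ f hf h
    rw [← Cocycle.toSingleMk_mem_coboundaries_iff f (add_zero n) (n-1) (by lia) hf (n+1) rfl, h,
      mem_coboundaries_iff _ (-1) (by simp)]
    constructor
    · intro h0
      have H : Homotopy φ 0 := HomotopyCategory.homotopyOfEq _ _ (h0.trans (Q.map_zero _ _).symm)
      obtain ⟨β, hβ⟩ := Cochain.equivHomotopy _ _ H
      exact ⟨β, by rw [Cochain.ofHom_zero, add_zero] at hβ; exact hβ.symm⟩
    · rintro ⟨β, hβ⟩
      have H : Homotopy φ 0 := (Cochain.equivHomotopy _ _).symm ⟨β, by simpa using hβ.symm⟩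
      exact (HomotopyCategory.eq_of_homotopy _ _ H).trans (Q.map_zero _ _)
  constructor
  · rintro hX Y a ⟨n, J, hJ, ⟨e⟩⟩
    rw [← cancel_mono e.hom, zero_comp]
    obtain ⟨φ, hφ⟩ : ∃ φ : X ⟶ (CochainComplex.singleFunctor _ n).obj J,
      Q.map φ = a ≫ e.hom := Q.map_surjective _
    rw [← hφ]
    obtain ⟨f, hf, h⟩ := Cocycle.toSingleMk_surjective (Cocycle.ofHom φ) n (add_zero n) (n-1)
      (by lia)
    exact (key J n φ f hf h).2 (hX J hJ n f hf)
  · intro hX J hJ n f hf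
    obtain ⟨φ, hφ⟩ := (Cocycle.equivHom _ _).surjective
      (Cocycle.toSingleMk f (add_zero n) (n-1) (by lia) hf)
    exact (key J n φ f hf hφ.symm).1 (hX (Y := Q.obj ((CochainComplex.singleFunctor _ n).obj J))
      (Q.map φ) ⟨n, J, hJ, ⟨Iso.refl _⟩⟩)

lemma aux_giW : giW A = (auxS A).leftOrthogonal.trW := by
  ext X Y f
  have key : ∀ g : X.as ⟶ Y.as, (auxS A).leftOrthogonal.trW
      ((HomotopyCategory.quotient _ _).map g) ↔ GIAcyclic A (CochainComplex.mappingCone g) :=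
    fun g => by
      rw [aux_giac]
      exact ObjectProperty.trW_iff_of_distinguished _ _
        (HomotopyCategory.mappingCone_triangleh_distinguished g)
  constructor
  · rintro ⟨g, rfl, hg⟩
    exact (key g).2 hg
  · intro hf
    obtain ⟨g, hg⟩ : ∃ g : X.as ⟶ Y.as, (HomotopyCategory.quotient _ _).map g = f :=
      (HomotopyCategory.quotient _ _).map_surjective f
    exact ⟨g, hg, (key g).1 (by rw [hg]; exact hf)⟩

end Aux

/-- The Gorenstein-injective derived category `D_GI(A)` has
arbitrary (small) coproducts. -/
theorem DGI_hasCoproducts : HasCoproducts.{u} (DGI A) := by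
  intro J
  have : (giW A).HasLeftCalculusOfFractions := by rw [aux_giW]; infer_instance
  have : (giW A).HasRightCalculusOfFractions := by rw [aux_giW]; infer_instance
  refine aux_loc_coprod (giW A).Q (giW A) J ?_
  rw [aux_giW, aux_trW]
  exact aux_isLocal_sigma _ J
end

section
/- Let A be a ring, and let 𝒫 be a non-empty class of A-modules which is closed under isomorphisms and direct summands and contains all projective A-modules. Let X be a right 𝒫-acyclic cochain complex of A-modules such that Xⁿ ∈ 𝒫 for all n ∈ ℤ. Then X is contractible if and only if all its cocycles ker(dⁿ_X) belong to 𝒫. -/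
open CategoryTheory CategoryTheory.Limits

universe u

variable (A : Type u) [Ring A]

/-- Let `𝒫` be a non-empty class of `A`-modules, closed under
isomorphisms and direct summands, containing all projective modules. A right
`𝒫`-acyclic complex with all terms in `𝒫` is contractible iff all its cocycles
`ker(dⁿ)` belong to `𝒫`. -/
theorem contractible_iff_cocycles_mem (P : ModuleCat.{u} A → Prop)
    (hne : ∃ M : ModuleCat.{u} A, P M)
    (hiso : ∀ M N : ModuleCat.{u} A, (M ≅ N) → P M → P N)
    (hsummand : ∀ M N : ModuleCat.{u} A,
      P N → (∃ (i : M ⟶ N) (r : N ⟶ M), i ≫ r = 𝟙 M) → P M)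
    (hproj : ∀ M : ModuleCat.{u} A, Module.Projective A M → P M)
    (X : Cplx A)
    (hacyc : ∀ M : ModuleCat.{u} A, P M → HomFromAcyclic A M X)
    (hterms : ∀ n : ℤ, P (X.X n)) :
    Contractible A X ↔ ∀ n : ℤ, P (kernel (X.d n (n + 1))) := by
  constructor
  · rintro ⟨h⟩ n
    have hc := h.comm n
    rw [dNext_eq h.hom (show (ComplexShape.up ℤ).Rel n (n + 1) by simp),
      prevD_eq h.hom (show (ComplexShape.up ℤ).Rel (n - 1) n by simp)] at hc
    refine hsummand _ (X.X (n - 1)) (hterms _)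
      ⟨kernel.ι (X.d n (n + 1)) ≫ h.hom n (n - 1),
        kernel.lift (X.d n (n + 1)) (X.d (n - 1) n) (by simp), ?_⟩
    rw [← cancel_mono (kernel.ι (X.d n (n + 1)))]
    have := congrArg (fun f => kernel.ι (X.d n (n + 1)) ≫ f) hc
    simp at this
    simpa using this.symm
  · intro hK
    have key : ∀ i j : ℤ, i + 1 = j → ∃ t : kernel (X.d j (j + 1)) ⟶ X.X i,
        t ≫ X.d i j = kernel.ι (X.d j (j + 1)) := by
      intro i j hij
      obtain rfl : i = j - 1 := by omega
      exact hacyc _ (hK j) j _ (kernel.condition _)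
    choose t ht using key
    let δ : ∀ n : ℤ, X.X n ⟶ kernel (X.d (n + 1) (n + 1 + 1)) := fun n =>
      kernel.lift _ (X.d n (n + 1)) (by simp)
    have hδ : ∀ n, δ n ≫ kernel.ι _ = X.d n (n + 1) := fun n => kernel.lift_ι _ _ _
    let p : ∀ n : ℤ, X.X n ⟶ kernel (X.d n (n + 1)) := fun n =>
      kernel.lift _ (𝟙 _ - δ n ≫ t n (n + 1) rfl) (by
        rw [Preadditive.sub_comp, Category.assoc, ht, hδ, Category.id_comp, sub_self])
    have hp : ∀ n, p n ≫ kernel.ι _ = 𝟙 _ - δ n ≫ t n (n + 1) rfl :=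
      fun n => kernel.lift_ι _ _ _
    have hdδ : ∀ n, X.d n (n + 1) ≫ δ (n + 1) = 0 := by
      intro n
      rw [← cancel_mono (kernel.ι _), Category.assoc, hδ]
      simp
    have hdp : ∀ n, X.d n (n + 1) ≫ p (n + 1) = δ n := by
      intro n
      rw [← cancel_mono (kernel.ι _), Category.assoc, hp, hδ, Preadditive.comp_sub,
        ← Category.assoc (X.d n (n + 1)), hdδ]
      simp
    refine ⟨{ hom := fun i j => if h : j + 1 = i then p i ≫ t j i h else 0
              zero := fun i j hij => dif_neg hij
              comm := fun n => ?_ }⟩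
    rw [dNext_eq _ (show (ComplexShape.up ℤ).Rel n (n + 1) by simp),
      prevD_eq _ (show (ComplexShape.up ℤ).Rel (n - 1) n by simp)]
    rw [dif_pos rfl, dif_pos (sub_add_cancel n 1), Category.assoc, ht, hp,
      ← Category.assoc, hdp]
    simp
end

section
/- Let A be a ring, and let X be a GP-acyclic cochain complex all of whose terms Xⁿ are Gorenstein-projective A-modules. Then X is contractible if and only if all its cocycles ker(dⁿ_X) are Gorenstein-projective A-modules. -/
open CategoryTheory CategoryTheory.Limits

universe u

variable (A : Type u) [Ring A]

namespace GPaux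

section

variable {A}

/-- elementwise short exactness -/
def SE {M P C : ModuleCat.{u} A} (i : M ⟶ P) (p : P ⟶ C) : Prop :=
  Function.Injective i ∧ Function.Surjective p ∧ ∀ x, p x = 0 ↔ ∃ m, i m = x

lemma SE.w {M P C : ModuleCat.{u} A} {i : M ⟶ P} {p : P ⟶ C} (h : SE i p) : i ≫ p = 0 := by
  ext x
  exact (h.2.2 _).2 ⟨x, rfl⟩

lemma SE.shortExact {M P C : ModuleCat.{u} A} {i : M ⟶ P} {p : P ⟶ C} (h : SE i p) :
    (ShortComplex.mk i p h.w).ShortExact := by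
  have : Mono i := (ModuleCat.mono_iff_injective _).2 h.1
  have : Epi p := (ModuleCat.epi_iff_surjective _).2 h.2.1
  refine ⟨?_⟩
  rw [ShortComplex.moduleCat_exact_iff]
  intro x hx
  exact (h.2.2 x).1 hx

lemma SE.desc {M P C K : ModuleCat.{u} A} {i : M ⟶ P} {p : P ⟶ C} (h : SE i p)
    (k : P ⟶ K) (hk : i ≫ k = 0) : ∃ l : C ⟶ K, p ≫ l = k := by
  have : Epi p := (ModuleCat.epi_iff_surjective _).2 h.2.1
  have : Epi (ShortComplex.mk i p h.w).g := this
  exact ⟨h.shortExact.exact.desc k hk, h.shortExact.exact.g_desc k hk⟩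

lemma exists_coker {M P : ModuleCat.{u} A} (i : M ⟶ P) (hi : Function.Injective i) :
    ∃ (C : ModuleCat.{u} A) (p : P ⟶ C), SE i p := by
  refine ⟨ModuleCat.of A (P ⧸ LinearMap.range i.hom),
    ModuleCat.ofHom (LinearMap.range i.hom).mkQ, hi, ?_, ?_⟩
  · exact Submodule.mkQ_surjective _
  · intro x
    exact (Submodule.Quotient.mk_eq_zero _).trans LinearMap.mem_range

/-- vanishing of Ext into projectives -/
def Perp (M : ModuleCat.{u} A) : Prop :=
  ∀ Q : ModuleCat.{u} A, Module.Projective A Q → ∀ n : ℕ, ∀ x : Abelian.Ext.{u} M Q (n + 1), x = 0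

lemma proj_cat {P : ModuleCat.{u} A} (h : Module.Projective A P) : Projective P :=
  (IsProjective.iff_projective (R := A) (P := P)).1 h

lemma Perp.ext {M E N : ModuleCat.{u} A} {i : M ⟶ E} {p : E ⟶ N} (h : SE i p)
    (hM : Perp M) (hN : Perp N) : Perp E := by
  intro Q hQ n x
  obtain ⟨y, rfl⟩ := Abelian.Ext.contravariant_sequence_exact₂ h.shortExact Q x (hM Q hQ n _)
  have : y = 0 := hN Q hQ n y
  rw [this, Abelian.Ext.comp_zero]

lemma Perp.ker {M P N : ModuleCat.{u} A} {i : M ⟶ P} {p : P ⟶ N} (h : SE i p)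
    (hP : Module.Projective A P) (hN : Perp N) : Perp M := by
  intro Q hQ n x
  have := proj_cat hP
  obtain ⟨y, rfl⟩ := Abelian.Ext.contravariant_sequence_exact₁ h.shortExact Q x
    (n₁ := n + 1 + 1) (by omega) (hN Q hQ (n + 1) _)
  have : y = 0 := Abelian.Ext.eq_zero_of_projective (P := P) y
  rw [this, Abelian.Ext.comp_zero]

lemma Perp.retract {M G : ModuleCat.{u} A} (i : M ⟶ G) (r : G ⟶ M) (h : i ≫ r = 𝟙 M)
    (hG : Perp G) : Perp M := by
  intro Q hQ n x
  have h1 := hG Q hQ n ((Abelian.Ext.mk₀ r).comp x (zero_add _))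
  rw [← Abelian.Ext.mk₀_id_comp x, ← h, ← Abelian.Ext.mk₀_comp_mk₀_assoc, h1,
    Abelian.Ext.comp_zero]

lemma Perp.extend {M P N Q : ModuleCat.{u} A} {i : M ⟶ P} {p : P ⟶ N} (h : SE i p)
    (hN : Perp N) (hQ : Module.Projective A Q) (f : M ⟶ Q) : ∃ g : P ⟶ Q, i ≫ g = f := by
  obtain ⟨y, hy⟩ := Abelian.Ext.contravariant_sequence_exact₁ h.shortExact Q (Abelian.Ext.mk₀ f)
    (n₁ := 0 + 1) (by omega) (hN Q hQ 0 _)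
  obtain ⟨g, rfl⟩ := (Abelian.Ext.mk₀_bijective _ _).2 y
  refine ⟨g, (Abelian.Ext.mk₀_bijective _ _).1 ?_⟩
  rw [← hy, Abelian.Ext.mk₀_comp_mk₀]

/-- one dimension shifting step -/
lemma shift_zero {M P N Q : ModuleCat.{u} A} {i : M ⟶ P} {p : P ⟶ N} (h : SE i p)
    (hP : Module.Projective A P) (n : ℕ)
    (hM : ∀ x : Abelian.Ext.{u} M Q (n + 1), x = 0) (x : Abelian.Ext.{u} N Q (n + 1 + 1)) :
    x = 0 := by
  have := proj_cat hP
  obtain ⟨y, rfl⟩ := Abelian.Ext.contravariant_sequence_exact₃ h.shortExact Q x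
    (Abelian.Ext.eq_zero_of_projective (P := P) _) (n₀ := n + 1) (by omega)
  have : y = 0 := hM y
  rw [this, Abelian.Ext.comp_zero]

lemma shift_zero_base {M P N Q : ModuleCat.{u} A} {i : M ⟶ P} {p : P ⟶ N} (h : SE i p)
    (hP : Module.Projective A P)
    (hM : ∀ f : M ⟶ Q, ∃ g : P ⟶ Q, i ≫ g = f) (x : Abelian.Ext.{u} N Q (0 + 1)) :
    x = 0 := by
  have := proj_cat hP
  obtain ⟨y, rfl⟩ := Abelian.Ext.contravariant_sequence_exact₃ h.shortExact Q x
    (Abelian.Ext.eq_zero_of_projective (P := P) _) (n₀ := 0) (by omega)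
  obtain ⟨f, rfl⟩ := (Abelian.Ext.mk₀_bijective _ _).2 y
  obtain ⟨g, rfl⟩ := hM f
  rw [← Abelian.Ext.mk₀_comp_mk₀ i g]
  exact h.shortExact.extClass_comp_assoc _

/-- classes closed under the right step -/
def Step (S : ModuleCat.{u} A → Prop) : Prop :=
  ∀ M, S M → Perp M ∧ ∃ (P C : ModuleCat.{u} A) (i : M ⟶ P) (p : P ⟶ C),
    SE i p ∧ Module.Projective A P ∧ S C

/-- the largest such class -/
def W (M : ModuleCat.{u} A) : Prop := ∃ S, Step S ∧ S M

lemma W.step : Step (A := A) W := by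
  rintro M ⟨S, hS, hM⟩
  obtain ⟨h, P, C, i, p, hip, hP, hC⟩ := hS M hM
  exact ⟨h, P, C, i, p, hip, hP, S, hS, hC⟩

lemma W.ext {M E N : ModuleCat.{u} A} {i : M ⟶ E} {p : E ⟶ N} (h : SE i p)
    (hM : W M) (hN : W N) : W E := by
  refine ⟨fun E => ∃ (M N : ModuleCat.{u} A) (i : M ⟶ E) (p : E ⟶ N), SE i p ∧ W M ∧ W N,
    ?_, M, N, i, p, h, hM, hN⟩
  clear h hM hN i p M N E
  rintro E ⟨M₁, M₂, a, b, hab, h₁, h₂⟩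
  obtain ⟨q₁, P₁, C₁, i₁, p₁, e₁, hP₁, hC₁⟩ := W.step _ h₁
  obtain ⟨q₂, P₂, C₂, i₂, p₂, e₂, hP₂, hC₂⟩ := W.step _ h₂
  refine ⟨Perp.ext hab q₁ q₂, ?_⟩
  obtain ⟨f, hf⟩ := Perp.extend hab q₂ hP₁ i₁
  have hf' : ∀ m, f (a m) = i₁ m := fun m => by rw [← hf]; rfl
  let j : E ⟶ ModuleCat.of A (P₁ × P₂) := ModuleCat.ofHom (f.hom.prod (b ≫ i₂).hom)
  have hj : ∀ e, j e = (f e, i₂ (b e)) := fun e => rfl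
  have jinj : Function.Injective j := by
    rw [injective_iff_map_eq_zero]
    intro e he
    rw [hj, Prod.mk_eq_zero] at he
    have hb : b e = 0 := e₂.1 (by rw [he.2, map_zero])
    obtain ⟨m, rfl⟩ := (hab.2.2 e).1 hb
    have : m = 0 := e₁.1 (by rw [← hf', he.1, map_zero])
    rw [this, map_zero]
  obtain ⟨C, π, hπ⟩ := exists_coker j jinj
  let inl : P₁ ⟶ ModuleCat.of A (P₁ × P₂) := ModuleCat.ofHom (LinearMap.inl A P₁ P₂)
  let snd : ModuleCat.of A (P₁ × P₂) ⟶ P₂ := ModuleCat.ofHom (LinearMap.snd A P₁ P₂)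
  obtain ⟨u, hu⟩ := e₁.desc (inl ≫ π) (by
    ext m
    refine (hπ.2.2 _).2 ⟨a m, ?_⟩
    rw [hj, hf', (hab.2.2 (a m)).2 ⟨m, rfl⟩, map_zero]
    rfl)
  obtain ⟨v, hv⟩ := hπ.desc (snd ≫ p₂) (by
    ext e
    exact (e₂.2.2 _).2 ⟨b e, rfl⟩)
  have hu' : ∀ x, u (p₁ x) = π ((x, 0) : P₁ × P₂) := fun x => by
    have := congrArg (fun t => t x) (congrArg (fun t => (ConcreteCategory.hom t : P₁ → C)) hu)
    exact this
  have hv' : ∀ x : P₁ × P₂, v (π x) = p₂ x.2 := fun x => by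
    have := congrArg (fun t => t x) (congrArg (fun t => (ConcreteCategory.hom t : P₁ × P₂ → C₂)) hv)
    exact this
  refine ⟨_, C, j, π, hπ, inferInstanceAs (Module.Projective A (P₁ × P₂)), C₁, C₂, u, v,
    ⟨?_, ?_, ?_⟩, hC₁, hC₂⟩
  · rw [injective_iff_map_eq_zero]
    intro c hc
    obtain ⟨x, rfl⟩ := e₁.2.1 c
    rw [hu'] at hc
    obtain ⟨e, he⟩ := (hπ.2.2 _).1 hc
    rw [hj, Prod.mk.injEq] at he
    have hb : b e = 0 := e₂.1 (by rw [he.2, map_zero])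
    obtain ⟨m, rfl⟩ := (hab.2.2 e).1 hb
    exact (e₁.2.2 _).2 ⟨m, by rw [← hf', he.1]⟩
  · intro c
    obtain ⟨y, rfl⟩ := e₂.2.1 c
    exact ⟨π ((0, y) : P₁ × P₂), hv' _⟩
  · intro c
    constructor
    · obtain ⟨⟨x, y⟩, rfl⟩ := hπ.2.1 c
      intro hc
      rw [hv'] at hc
      obtain ⟨m₂, hm₂⟩ := (e₂.2.2 _).1 hc
      obtain ⟨e, rfl⟩ := hab.2.1 m₂
      refine ⟨p₁ (x - f e), ?_⟩
      rw [hu', ← sub_eq_zero, ← map_sub]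
      refine (hπ.2.2 _).2 ⟨-e, ?_⟩
      rw [map_neg, hj, hm₂]
      refine Prod.ext ?_ ?_
      · change - f e = (x - f e) - x
        abel
      · change - y = 0 - y
        abel
    · rintro ⟨c, rfl⟩
      obtain ⟨x, rfl⟩ := e₁.2.1 c
      rw [hu', hv', map_zero]

lemma W.retract {M G : ModuleCat.{u} A} (i : M ⟶ G) (r : G ⟶ M) (h : i ≫ r = 𝟙 M)
    (hG : W G) : W M := by
  refine ⟨fun M => ∃ (G : ModuleCat.{u} A) (i : M ⟶ G) (r : G ⟶ M), i ≫ r = 𝟙 M ∧ W G,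
    ?_, G, i, r, h, hG⟩
  clear h hG i r M G
  rintro M ⟨G, i, r, h, hG⟩
  obtain ⟨q₁, P, G', j, q, e, hP, hG'⟩ := W.step _ hG
  refine ⟨Perp.retract i r h q₁, ?_⟩
  have h' : ∀ m, r (i m) = m := fun m => by
    have := congrArg (fun t => t m) (congrArg (fun t => (ConcreteCategory.hom t : M → M)) h)
    exact this
  have iinj : Function.Injective i := Function.LeftInverse.injective h'
  obtain ⟨C, π, hπ⟩ := exists_coker (i ≫ j) (e.1.comp iinj)
  obtain ⟨v, hv⟩ := hπ.desc q (by rw [Category.assoc, e.w, comp_zero])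
  have hv' : ∀ x, v (π x) = q x := fun x => by rw [← hv]; rfl
  refine ⟨P, C, i ≫ j, π, hπ, hP, ModuleCat.of A (C × M),
    ModuleCat.ofHom (LinearMap.inl A C M), ModuleCat.ofHom (LinearMap.fst A C M), rfl, ?_⟩
  let φ : G ⟶ ModuleCat.of A (C × M) := ModuleCat.ofHom ((j ≫ π).hom.prod r.hom)
  let ψ : ModuleCat.of A (C × M) ⟶ G' := ModuleCat.ofHom (LinearMap.fst A C M) ≫ v
  have hφ : ∀ g, φ g = (π (j g), r g) := fun g => rfl
  have hψ : ∀ x : C × M, ψ x = v x.1 := fun g => rfl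
  have hij : ∀ m, π (j (i m)) = 0 := fun m => (hπ.2.2 _).2 ⟨m, rfl⟩
  refine W.ext (i := φ) (p := ψ) ⟨?_, ?_, ?_⟩ hG hG'
  · rw [injective_iff_map_eq_zero]
    intro g hg
    rw [hφ, Prod.mk_eq_zero] at hg
    obtain ⟨m, hm⟩ := (hπ.2.2 _).1 hg.1
    have : i m = g := e.1 hm
    subst this
    rw [h'] at hg
    rw [hg.2, map_zero]
  · intro c
    obtain ⟨y, rfl⟩ := e.2.1 c
    exact ⟨((π y, 0) : C × M), by rw [hψ]; exact hv' _⟩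
  · rintro ⟨c, m⟩
    obtain ⟨y, rfl⟩ := hπ.2.1 c
    rw [hψ]
    change v (π y) = 0 ↔ _
    rw [hv', e.2.2]
    constructor
    · rintro ⟨g, rfl⟩
      refine ⟨g + i (m - r g), ?_⟩
      rw [hφ, map_add, map_add, map_add, hij, h']
      refine Prod.ext ?_ ?_
      · change _ + 0 = _
        rw [add_zero]
      · change r g + (m - r g) = m
        abel
    · rintro ⟨g, hg⟩
      rw [hφ, Prod.mk.injEq] at hg
      have : q (j g) = q y := by rw [← hv', ← hv', hg.1]
      have h0 : q (j g) = 0 := (e.2.2 _).2 ⟨g, rfl⟩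
      exact (e.2.2 _).1 (this.symm.trans h0)

lemma W.left {M : ModuleCat.{u} A} (hM : W M) :
    ∃ (K P : ModuleCat.{u} A) (i : K ⟶ P) (p : P ⟶ M), SE i p ∧ Module.Projective A P ∧ W K := by
  let p := Projective.π M
  have hp : Function.Surjective p := (ModuleCat.epi_iff_surjective _).1 inferInstance
  let i : ModuleCat.of A (LinearMap.ker p.hom) ⟶ Projective.over M :=
    ModuleCat.ofHom (LinearMap.ker p.hom).subtype
  have hip : SE i p := by
    refine ⟨Subtype.val_injective, hp, fun x => ⟨fun h => ⟨⟨x, h⟩, rfl⟩, ?_⟩⟩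
    rintro ⟨m, rfl⟩
    exact m.2
  have hP : Module.Projective A (Projective.over M : ModuleCat.{u} A) :=
    (IsProjective.iff_projective (R := A) (P := (Projective.over M : ModuleCat.{u} A))).2
      (Projective.projective_over M)
  refine ⟨_, _, i, p, hip, hP, fun N => W N ∨ N = ModuleCat.of A (LinearMap.ker p.hom), ?_,
    Or.inr rfl⟩
  rintro N (hN | rfl)
  · obtain ⟨h, P, C, i, p, h1, h2, h3⟩ := W.step _ hN
    exact ⟨h, P, C, i, p, h1, h2, Or.inl h3⟩
  · exact ⟨Perp.ker hip hP (W.step _ hM).1, _, _, i, p, hip, hP, Or.inl hM⟩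

lemma exists_seq {α : Type*} (R : α → α → Prop) (hr : ∀ a, ∃ b, R a b) (hl : ∀ a, ∃ b, R b a)
    (a : α) : ∃ s : ℤ → α, s 0 = a ∧ ∀ n, R (s n) (s (n + 1)) := by
  choose f hf using hr
  choose g hg using hl
  refine ⟨fun n => match n with
    | Int.ofNat k => f^[k] a
    | Int.negSucc k => g^[k + 1] a, rfl, ?_⟩
  rintro (k | k)
  · change R (f^[k] a) (f^[k + 1] a)
    rw [Function.iterate_succ_apply']
    exact hf _
  · cases k with
    | zero => exact hg a
    | succ k =>
      change R (g^[k + 2] a) (g^[k + 1] a)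
      rw [Function.iterate_succ_apply' g (k + 1)]
      exact hg _

lemma W.gp {M : ModuleCat.{u} A} (hM : W M) : IsGorensteinProjective A M := by
  obtain ⟨s, hs0, hs⟩ := exists_seq (α := {M : ModuleCat.{u} A // W M})
    (fun M N => ∃ (P : ModuleCat.{u} A) (i : M.1 ⟶ P) (p : P ⟶ N.1), SE i p ∧ Module.Projective A P)
    (by
      rintro ⟨M, hM⟩
      obtain ⟨-, P, C, i, p, h1, h2, h3⟩ := W.step _ hM
      exact ⟨⟨C, h3⟩, P, i, p, h1, h2⟩)
    (by
      rintro ⟨M, hM⟩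
      obtain ⟨K, P, i, p, h1, h2, h3⟩ := W.left hM
      exact ⟨⟨K, h3⟩, P, i, p, h1, h2⟩) ⟨M, hM⟩
  choose P i p hip hP using hs
  have epi : ∀ n, Epi (p n) := fun n => (ModuleCat.epi_iff_surjective _).2 (hip n).2.1
  have mono : ∀ n, Mono (i n) := fun n => (ModuleCat.mono_iff_injective _).2 (hip n).1
  let T : Cplx A := CochainComplex.of P (fun n => p n ≫ i (n + 1)) (fun n => by
    rw [Category.assoc, reassoc_of% (hip (n + 1)).w, zero_comp, comp_zero])
  have hd : ∀ n, T.d n (n + 1) = p n ≫ i (n + 1) := fun n => CochainComplex.of_d P (fun n => p n ≫ i (n + 1)) n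
  refine ⟨T, ?_, hP, ?_, ?_⟩
  · intro n
    obtain ⟨m, rfl⟩ : ∃ m, n = m + 1 := ⟨n - 1, by omega⟩
    rw [T.exactAt_iff' m (m + 1) (m + 1 + 1) (by simp) (by simp), ShortComplex.moduleCat_exact_iff]
    intro x hx
    change T.d (m + 1) (m + 1 + 1) x = 0 at hx
    rw [hd] at hx
    have h1 : p (m + 1) x = 0 := (hip (m + 1 + 1)).1 (by rw [map_zero]; exact hx)
    obtain ⟨z, rfl⟩ := ((hip (m + 1)).2.2 x).1 h1
    obtain ⟨y, rfl⟩ := (hip m).2.1 z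
    refine ⟨y, ?_⟩
    change T.d m (m + 1) y = _
    rw [hd]
    rfl
  · intro Q hQ n f hf
    obtain ⟨m, rfl⟩ : ∃ m, n = m + 1 := ⟨n - 1, by omega⟩
    rw [show m + 1 - 1 = m by omega, hd, Category.assoc] at hf
    have h1 : i (m + 1) ≫ f = 0 := by
      rw [← cancel_epi (p m), hf, comp_zero]
    obtain ⟨l, hl⟩ := (hip (m + 1)).desc f h1
    obtain ⟨g, hg⟩ := Perp.extend (hip (m + 1 + 1)) (W.step _ (s (m + 1 + 1 + 1)).2).1 hQ l
    refine ⟨g, ?_⟩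
    rw [hd, Category.assoc]
    exact (congrArg (p (m + 1) ≫ ·) hg).trans hl
  · have hM0 : M = (s 0).1 := by rw [hs0]
    subst hM0
    have h1 : i 0 ≫ T.d 0 (0 + 1) = 0 := by
      rw [hd, reassoc_of% (hip 0).w, zero_comp]
    have hk : (ShortComplex.mk (i 0) (T.d 0 (0 + 1)) h1).Exact := by
      rw [ShortComplex.moduleCat_exact_iff]
      intro x hx
      change T.d 0 (0 + 1) x = 0 at hx
      rw [hd] at hx
      have h1 : p 0 x = 0 := (hip (0 + 1)).1 (by rw [map_zero]; exact hx)
      exact ((hip 0).2.2 x).1 h1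
    have : Mono (ShortComplex.mk (i 0) (T.d 0 (0 + 1)) h1).f := mono 0
    have iso : Nonempty ((s 0).1 ≅ kernel (T.d 0 (0 + 1))) :=
      ⟨hk.fIsKernel.conePointUniqueUpToIso (limit.isLimit _)⟩
    exact iso

lemma cocycle_SE (P : Cplx A) (hP : IsAcyclicComplex A P) (n : ℤ) :
    ∃ p : P.X n ⟶ kernel (P.d (n + 1) (n + 1 + 1)),
      p ≫ kernel.ι _ = P.d n (n + 1) ∧ SE (kernel.ι (P.d n (n + 1))) p := by
  have h := hP (n + 1)
  rw [P.exactAt_iff' n (n + 1) (n + 1 + 1) (by simp) (by simp),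
    ShortComplex.moduleCat_exact_iff] at h
  let p : P.X n ⟶ kernel (P.d (n + 1) (n + 1 + 1)) := kernel.lift _ (P.d n (n + 1)) (by simp)
  have hp : p ≫ kernel.ι _ = P.d n (n + 1) := kernel.lift_ι _ _ _
  have hp' : ∀ x, kernel.ι (P.d (n + 1) (n + 1 + 1)) (p x) = P.d n (n + 1) x := fun x => by
    rw [← hp]; rfl
  have inj : ∀ k, Function.Injective (kernel.ι (P.d k (k + 1))) := fun k =>
    (ModuleCat.mono_iff_injective _).1 inferInstance
  refine ⟨p, hp, inj n, ?_, ?_⟩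
  · intro z
    obtain ⟨x, hx⟩ := h (kernel.ι (P.d (n + 1) (n + 1 + 1)) z) (by
      change (kernel.ι (P.d (n + 1) (n + 1 + 1)) ≫ P.d (n + 1) (n + 1 + 1)) z = 0
      rw [kernel.condition]; rfl)
    exact ⟨x, inj _ ((hp' x).trans hx)⟩
  · intro x
    have h0 : p x = 0 ↔ P.d n (n + 1) x = 0 := by
      rw [← hp']
      constructor
      · intro h; rw [h, map_zero]
      · intro h; exact inj _ (by rw [h, map_zero])
    rw [h0]
    constructor
    · intro hx
      let t : ModuleCat.of A (LinearMap.ker (P.d n (n + 1)).hom) ⟶ P.X n :=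
        ModuleCat.ofHom (LinearMap.ker (P.d n (n + 1)).hom).subtype
      have ht : t ≫ P.d n (n + 1) = 0 := by
        ext y
        exact y.2
      refine ⟨kernel.lift _ t ht ⟨x, hx⟩, ?_⟩
      change (kernel.lift _ t ht ≫ kernel.ι _) ⟨x, hx⟩ = x
      rw [kernel.lift_ι]
      rfl
    · rintro ⟨z, rfl⟩
      change (kernel.ι (P.d n (n + 1)) ≫ P.d n (n + 1)) z = 0
      rw [kernel.condition]; rfl

lemma gp_W {M : ModuleCat.{u} A} (hM : IsGorensteinProjective A M) : W M := by
  obtain ⟨P, hac, hP, hQ, ⟨e⟩⟩ := hM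
  have perp : ∀ n, Perp (kernel (P.d n (n + 1))) := by
    intro n Q hQp k
    induction k generalizing n with
    | zero =>
      obtain ⟨m, rfl⟩ : ∃ m, n = m + 1 + 1 := ⟨n - 2, by omega⟩
      obtain ⟨p, -, hp⟩ := cocycle_SE P hac (m + 1)
      intro x
      refine shift_zero_base hp (hP _) ?_ x
      intro f
      obtain ⟨p', hp1, hp2⟩ := cocycle_SE P hac m
      have : Epi p' := (ModuleCat.epi_iff_surjective _).2 hp2.2.1
      obtain ⟨g, hg⟩ := hQ Q hQp m (p' ≫ f) (by
        have h0 : P.d (m - 1) m ≫ p' = 0 := by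
          rw [← cancel_mono (kernel.ι _), Category.assoc, hp1, zero_comp, P.d_comp_d]
        rw [reassoc_of% h0, zero_comp])
      refine ⟨g, ?_⟩
      rw [← cancel_epi p', reassoc_of% hp1, hg]
    | succ k ih =>
      obtain ⟨m, rfl⟩ : ∃ m, n = m + 1 := ⟨n - 1, by omega⟩
      obtain ⟨p, -, hp⟩ := cocycle_SE P hac m
      exact shift_zero hp (hP _) k (ih m)
  refine W.retract e.hom e.inv e.hom_inv_id
    ⟨fun N => ∃ n, N = kernel (P.d n (n + 1)), ?_, 0, rfl⟩
  rintro _ ⟨n, rfl⟩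
  obtain ⟨p, -, hp⟩ := cocycle_SE P hac n
  exact ⟨perp n, _, _, _, p, hp, hP n, n + 1, rfl⟩

end

end GPaux

/-- A GP-acyclic complex of Gorenstein-projective modules is
contractible iff all its cocycles `ker(dⁿ)` are Gorenstein-projective. -/
theorem GPAcyclic_contractible_iff_cocycles_gp (X : Cplx A)
    (hacyc : GPAcyclic A X)
    (hterms : ∀ n : ℤ, IsGorensteinProjective A (X.X n)) :
    Contractible A X ↔
      ∀ n : ℤ, IsGorensteinProjective A (kernel (X.d n (n + 1))) := by
  constructor
  · rintro ⟨h⟩ n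
    have hc := h.comm n
    rw [dNext_eq h.hom (show (ComplexShape.up ℤ).Rel n (n + 1) from rfl),
      prevD_eq h.hom (show (ComplexShape.up ℤ).Rel (n - 1) n by simp)] at hc
    simp only [HomologicalComplex.id_f, HomologicalComplex.zero_f, add_zero] at hc
    refine GPaux.W.gp (GPaux.W.retract (kernel.ι (X.d n (n + 1)))
      (kernel.lift _ (h.hom n (n - 1) ≫ X.d (n - 1) n) (by simp)) ?_ (GPaux.gp_W (hterms n)))
    rw [← cancel_mono (kernel.ι _), Category.assoc, kernel.lift_ι, Category.id_comp]
    have := congrArg (kernel.ι (X.d n (n + 1)) ≫ ·) hc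
    simp only [Category.comp_id, Preadditive.comp_add, kernel.condition_assoc, zero_comp,
      zero_add] at this
    exact this.symm
  · intro hZ
    have key : ∀ n : ℤ, ∃ s : kernel (X.d (n + 1) (n + 1 + 1)) ⟶ X.X n,
        s ≫ X.d n (n + 1) = kernel.ι _ := by
      intro n
      have := hacyc _ (hZ (n + 1)) (n + 1) (kernel.ι _) (kernel.condition _)
      rwa [show n + 1 - 1 = n by omega] at this
    choose s hs using key
    let π : ∀ n : ℤ, X.X n ⟶ kernel (X.d (n + 1) (n + 1 + 1)) := fun n =>
      kernel.lift _ (X.d n (n + 1)) (by simp)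
    have hπ : ∀ n, π n ≫ kernel.ι _ = X.d n (n + 1) := fun n => kernel.lift_ι _ _ _
    let ρ : ∀ n : ℤ, X.X n ⟶ kernel (X.d n (n + 1)) := fun n =>
      kernel.lift _ (𝟙 _ - π n ≫ s n) (by
        rw [Preadditive.sub_comp, Category.assoc, hs, hπ, Category.id_comp, sub_self])
    have hρ : ∀ n, ρ n ≫ kernel.ι _ = 𝟙 _ - π n ≫ s n := fun n => kernel.lift_ι _ _ _
    have hπρ : ∀ n, X.d n (n + 1) ≫ ρ (n + 1) = π n := by
      intro n
      rw [← cancel_mono (kernel.ι _), Category.assoc, hρ, hπ, Preadditive.comp_sub,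
        Category.comp_id]
      have : X.d n (n + 1) ≫ π (n + 1) = 0 := by
        rw [← cancel_mono (kernel.ι _), Category.assoc, hπ, zero_comp, X.d_comp_d]
      rw [reassoc_of% this, zero_comp, sub_zero]
    let hh : ∀ i j : ℤ, X.X i ⟶ X.X j := fun i j =>
      if e : j + 1 = i then eqToHom (by rw [e]) ≫ ρ (j + 1) ≫ s j else 0
    have hh1 : ∀ j, hh (j + 1) j = ρ (j + 1) ≫ s j := fun j => by simp [hh]
    refine ⟨{ hom := hh, zero := ?_, comm := ?_ }⟩
    · intro i j hij
      exact dif_neg hij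
    · intro n
      obtain ⟨m, rfl⟩ : ∃ m, n = m + 1 := ⟨n - 1, by omega⟩
      rw [dNext_eq hh (show (ComplexShape.up ℤ).Rel (m + 1) (m + 1 + 1) from rfl),
        prevD_eq hh (show (ComplexShape.up ℤ).Rel m (m + 1) from rfl), hh1, hh1,
        Category.assoc, hs, hρ, reassoc_of% hπρ]
      simp
end

section
/- Let A be a ring such that FPD(A) < ∞. Then every bounded below GP-acyclic cochain complex of Gorenstein-projective A-modules is contractible. -/
open CategoryTheory CategoryTheory.Limits

universe u

variable (A : Type u) [Ring A]

section Helpers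

variable {A}

/-- short exact sequence with concrete maps -/
def SxM {X Y Z : ModuleCat.{u} A} (f : X →ₗ[A] Y) (g : Y →ₗ[A] Z) : Prop :=
  Function.Injective f ∧ Function.Surjective g ∧ Function.Exact f g

/-- existence of a short exact sequence -/
def Sx (X Y Z : ModuleCat.{u} A) : Prop :=
  ∃ (f : X →ₗ[A] Y) (g : Y →ₗ[A] Z), SxM f g

/-- Vanishing of Ext to all projectives in degree i. -/
def VE (M : ModuleCat.{u} A) (i : ℕ) : Prop :=
  ∀ Q : ModuleCat.{u} A, Module.Projective A Q → Subsingleton (Abelian.Ext.{u} M Q i)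

lemma SxM.comp_zero {X Y Z : ModuleCat.{u} A} {f : X →ₗ[A] Y} {g : Y →ₗ[A] Z}
    (h : SxM f g) : ModuleCat.ofHom f ≫ ModuleCat.ofHom g = 0 := by
  ext x
  exact h.2.2.apply_apply_eq_zero x

lemma SxM.shortExact {X Y Z : ModuleCat.{u} A} {f : X →ₗ[A] Y} {g : Y →ₗ[A] Z}
    (h : SxM f g) :
    (ShortComplex.mk (ModuleCat.ofHom f) (ModuleCat.ofHom g) h.comp_zero).ShortExact :=
  ModuleCat.shortComplex_shortExact _ h.2.2 h.1 h.2.1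

lemma VE_mid {X Y Z : ModuleCat.{u} A} (h : Sx X Y Z) {i : ℕ} (hX : VE X i) (hZ : VE Z i) :
    VE Y i := by
  obtain ⟨f, g, h⟩ := h
  intro Q hQ
  have := hX Q hQ
  have := hZ Q hQ
  refine subsingleton_of_forall_eq 0 fun x => ?_
  obtain ⟨y, hy⟩ := Abelian.Ext.contravariant_sequence_exact₂ h.shortExact Q x
    (Subsingleton.elim _ _)
  rw [← hy, Subsingleton.elim y 0, Abelian.Ext.comp_zero]

lemma VE_right {X Y Z : ModuleCat.{u} A} (h : Sx X Y Z) {i : ℕ} (hX : VE X i) (hY : VE Y (i+1)) :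
    VE Z (i+1) := by
  obtain ⟨f, g, h⟩ := h
  intro Q hQ
  have := hX Q hQ
  have := hY Q hQ
  refine subsingleton_of_forall_eq 0 fun x => ?_
  obtain ⟨y, hy⟩ := Abelian.Ext.contravariant_sequence_exact₃ h.shortExact Q x
    (Subsingleton.elim _ _) (n₀ := i) (by omega)
  rw [← hy, Subsingleton.elim y 0, Abelian.Ext.comp_zero]

lemma VE_left {X Y Z : ModuleCat.{u} A} (h : Sx X Y Z) {i : ℕ} (hY : VE Y i) (hZ : VE Z (i+1)) :
    VE X i := by
  obtain ⟨f, g, h⟩ := h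
  intro Q hQ
  have := hY Q hQ
  have := hZ Q hQ
  refine subsingleton_of_forall_eq 0 fun x => ?_
  obtain ⟨y, hy⟩ := Abelian.Ext.contravariant_sequence_exact₁ h.shortExact Q x
    (n₁ := i+1) (by omega) (Subsingleton.elim _ _)
  rw [← hy, Subsingleton.elim y 0, Abelian.Ext.comp_zero]

lemma VE_proj {M : ModuleCat.{u} A} (h : Module.Projective A M) (i : ℕ) : VE M (i+1) := by
  intro Q _
  have : CategoryTheory.Projective M := ModuleCat.projective_of_categoryTheory_projective M
  exact HasProjectiveDimensionLT.subsingleton M 1 (i+1) (by omega) Q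

lemma extend_of_VE {X Y Z : ModuleCat.{u} A} {f : X →ₗ[A] Y} {g : Y →ₗ[A] Z}
    (h : SxM f g) (hZ : VE Z 1) (Q : ModuleCat.{u} A) (hQ : Module.Projective A Q)
    (a : X →ₗ[A] Q) : ∃ b : Y →ₗ[A] Q, b ∘ₗ f = a := by
  have := hZ Q hQ
  obtain ⟨y, hy⟩ := Abelian.Ext.contravariant_sequence_exact₁ h.shortExact Q
    (Abelian.Ext.mk₀ (ModuleCat.ofHom a)) (n₁ := 1) (by omega) (Subsingleton.elim _ _)
  obtain ⟨b, rfl⟩ := (Abelian.Ext.mk₀_bijective _ _).2 y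
  rw [Abelian.Ext.mk₀_comp_mk₀] at hy
  have := (Abelian.Ext.mk₀_bijective _ _).1 hy
  refine ⟨b.hom, ?_⟩
  simpa using congrArg ModuleCat.Hom.hom this

lemma VE_of_extend {X Y Z : ModuleCat.{u} A} {f : X →ₗ[A] Y} {g : Y →ₗ[A] Z}
    (h : SxM f g) (hY : VE Y 1)
    (hex : ∀ (Q : ModuleCat.{u} A) (_ : Module.Projective A Q)
      (a : X →ₗ[A] Q), ∃ b : Y →ₗ[A] Q, b ∘ₗ f = a) : VE Z 1 := by
  intro Q hQ
  have := hY Q hQ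
  refine subsingleton_of_forall_eq 0 fun x => ?_
  obtain ⟨y, hy⟩ := Abelian.Ext.contravariant_sequence_exact₃ h.shortExact Q x
    (Subsingleton.elim _ _) (n₀ := 0) (by omega)
  obtain ⟨a, rfl⟩ := (Abelian.Ext.mk₀_bijective _ _).2 y
  obtain ⟨b, hb⟩ := hex Q hQ a.hom
  have e : a = ModuleCat.ofHom f ≫ ModuleCat.ofHom b := by
    ext x
    exact (congrArg (fun t => t x) hb).symm
  rw [← hy, e, ← Abelian.Ext.mk₀_comp_mk₀]
  exact h.shortExact.extClass_comp_assoc _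

lemma Sx_iso_left {X Y Z X' : ModuleCat.{u} A} (h : Sx X Y Z) (e : X' ≃ₗ[A] X) : Sx X' Y Z := by
  obtain ⟨f, g, h1, h2, h3⟩ := h
  refine ⟨f ∘ₗ e.toLinearMap, g, h1.comp e.injective, h2, fun y => ?_⟩
  rw [h3 y]
  constructor
  · rintro ⟨x, rfl⟩
    exact ⟨e.symm x, by simp⟩
  · rintro ⟨x, rfl⟩
    exact ⟨e x, rfl⟩

lemma Sx_iso_mid {X Y Z Y' : ModuleCat.{u} A} (h : Sx X Y Z) (e : Y ≃ₗ[A] Y') : Sx X Y' Z := by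
  obtain ⟨f, g, h1, h2, h3⟩ := h
  refine ⟨e.toLinearMap ∘ₗ f, g ∘ₗ e.symm.toLinearMap, e.injective.comp h1,
    h2.comp e.symm.surjective, fun y => ?_⟩
  constructor
  · intro hy
    obtain ⟨x, hx⟩ := (h3 _).1 hy
    exact ⟨x, by simp [hx]⟩
  · rintro ⟨x, rfl⟩
    simpa using h3.apply_apply_eq_zero x

lemma Sx_prod (X Z : ModuleCat.{u} A) : Sx X (ModuleCat.of A (X × Z)) Z :=
  ⟨LinearMap.inl A X Z, LinearMap.snd A X Z, LinearMap.inl_injective, LinearMap.snd_surjective,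
    Function.Exact.inl_snd⟩

lemma Sx_of_equiv {X Y : ModuleCat.{u} A} (e : X ≃ₗ[A] Y) :
    Sx X Y (ModuleCat.of A PUnit.{u+1}) :=
  ⟨e.toLinearMap, 0, e.injective, fun _ => ⟨0, rfl⟩, fun y => ⟨fun _ => e.surjective y, fun _ => rfl⟩⟩

lemma Sx_add {X Y Z : ModuleCat.{u} A} (h : Sx X Y Z) (W : ModuleCat.{u} A) :
    Sx (ModuleCat.of A (X × W)) (ModuleCat.of A (Y × W)) Z := by
  obtain ⟨f, g, h1, h2, h3⟩ := h
  refine ⟨f.prodMap LinearMap.id, g ∘ₗ LinearMap.fst A Y W, ?_, ?_, ?_⟩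
  · exact h1.prodMap Function.injective_id
  · exact h2.comp LinearMap.fst_surjective
  · rintro ⟨y, w⟩
    constructor
    · intro hy
      obtain ⟨x, hx⟩ := (h3 y).1 hy
      exact ⟨(x, w), by simp [hx]⟩
    · rintro ⟨⟨x, w'⟩, hx⟩
      have : f x = y := congrArg Prod.fst hx
      subst this
      exact h3.apply_apply_eq_zero x

/-- pushout -/
lemma Sx_pushout {M X N Y G : ModuleCat.{u} A} (h : Sx M X N) (h' : Sx M Y G) :
    ∃ E : ModuleCat.{u} A, Sx Y E N ∧ Sx X E G := by
  obtain ⟨f, g, h1, h2, h3⟩ := h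
  obtain ⟨f', g', h1', h2', h3'⟩ := h'
  let R : Submodule A (X × Y) := LinearMap.range (f.prod (-f'))
  have hR1 : R ≤ LinearMap.ker (g ∘ₗ LinearMap.fst A X Y) := by
    rintro _ ⟨m, rfl⟩
    simpa using h3.apply_apply_eq_zero m
  have hR2 : R ≤ LinearMap.ker (g' ∘ₗ LinearMap.snd A X Y) := by
    rintro _ ⟨m, rfl⟩
    simpa using h3'.apply_apply_eq_zero m
  refine ⟨ModuleCat.of A ((X × Y) ⧸ R), ⟨R.mkQ ∘ₗ LinearMap.inr A X Y, R.liftQ _ hR1, ?_, ?_, ?_⟩,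
    ⟨R.mkQ ∘ₗ LinearMap.inl A X Y, R.liftQ _ hR2, ?_, ?_, ?_⟩⟩
  · rw [← LinearMap.ker_eq_bot, LinearMap.ker_eq_bot']
    intro y hy
    obtain ⟨m, hm⟩ := (Submodule.Quotient.mk_eq_zero R).1 hy
    have a1 : f m = 0 := congrArg Prod.fst hm
    have a2 : -f' m = y := congrArg Prod.snd hm
    rw [← a2, h1 (a1.trans f.map_zero.symm)]
    simp
  · intro n
    obtain ⟨x, rfl⟩ := h2 n
    exact ⟨R.mkQ (x, 0), rfl⟩
  · intro e
    obtain ⟨⟨x, y⟩, rfl⟩ := R.mkQ_surjective e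
    constructor
    · intro hx
      obtain ⟨m, hm⟩ := (h3 x).1 hx
      refine ⟨y + f' m, ?_⟩
      refine (Submodule.Quotient.eq R).2 ⟨-m, ?_⟩
      ext <;> simp [hm]
    · rintro ⟨y, hy⟩
      rw [← hy]
      exact g.map_zero
  · rw [← LinearMap.ker_eq_bot, LinearMap.ker_eq_bot']
    intro y hy
    obtain ⟨m, hm⟩ := (Submodule.Quotient.mk_eq_zero R).1 hy
    have a1 : f m = y := congrArg Prod.fst hm
    have a2 : -f' m = 0 := congrArg Prod.snd hm
    rw [← a1, h1' ((neg_eq_zero.1 a2).trans f'.map_zero.symm)]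
    simp
  · intro n
    obtain ⟨x, rfl⟩ := h2' n
    exact ⟨R.mkQ (0, x), rfl⟩
  · intro e
    obtain ⟨⟨x, y⟩, rfl⟩ := R.mkQ_surjective e
    constructor
    · intro hx
      obtain ⟨m, hm⟩ := (h3' y).1 hx
      refine ⟨x + f m, ?_⟩
      refine (Submodule.Quotient.eq R).2 ⟨m, ?_⟩
      ext <;> simp [hm]
    · rintro ⟨y, hy⟩
      rw [← hy]
      exact g'.map_zero

/-- third isomorphism theorem -/
lemma Sx_third {X Y Z C1 C2 : ModuleCat.{u} A} (h : Sx X Y C1) (h' : Sx Y Z C2) :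
    ∃ D : ModuleCat.{u} A, Sx X Z D ∧ Sx C1 D C2 := by
  obtain ⟨f, g, h1, h2, h3⟩ := h
  obtain ⟨f', g', h1', h2', h3'⟩ := h'
  let R : Submodule A Z := LinearMap.range (f' ∘ₗ f)
  have hR : R ≤ LinearMap.ker g' := by
    rintro _ ⟨m, rfl⟩
    simpa using h3'.apply_apply_eq_zero (f m)
  have hK : LinearMap.ker g ≤ LinearMap.ker (R.mkQ ∘ₗ f') := by
    intro y hy
    obtain ⟨x, rfl⟩ := (h3 y).1 hy
    exact (Submodule.Quotient.mk_eq_zero R).2 ⟨x, rfl⟩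
  let φ := (LinearMap.ker g).liftQ _ hK ∘ₗ (g.quotKerEquivOfSurjective h2).symm.toLinearMap
  have hφ : ∀ y, φ (g y) = R.mkQ (f' y) := by
    intro y
    have : (g.quotKerEquivOfSurjective h2).symm (g y) = Submodule.Quotient.mk y := by
      rw [LinearEquiv.symm_apply_eq]
      rfl
    simp only [φ, LinearMap.comp_apply, LinearEquiv.coe_coe, this]
    rfl
  refine ⟨ModuleCat.of A (Z ⧸ R), ⟨f' ∘ₗ f, R.mkQ, h1'.comp h1, R.mkQ_surjective, ?_⟩,
    ⟨φ, R.liftQ _ hR, ?_, ?_, ?_⟩⟩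
  · intro z
    exact Submodule.Quotient.mk_eq_zero R
  · rw [← LinearMap.ker_eq_bot, LinearMap.ker_eq_bot']
    intro c hc
    obtain ⟨y, rfl⟩ := h2 c
    rw [hφ] at hc
    obtain ⟨m, hm⟩ := (Submodule.Quotient.mk_eq_zero R).1 hc
    rw [← h1' hm]
    exact h3.apply_apply_eq_zero m
  · intro n
    obtain ⟨x, rfl⟩ := h2' n
    exact ⟨R.mkQ x, rfl⟩
  · intro e
    obtain ⟨z, rfl⟩ := R.mkQ_surjective e
    constructor
    · intro hz
      obtain ⟨y, rfl⟩ := (h3' z).1 hz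
      exact ⟨g y, hφ y⟩
    · rintro ⟨c, hc⟩
      obtain ⟨y, rfl⟩ := h2 c
      rw [← hc, hφ]
      exact h3'.apply_apply_eq_zero y

/-- splitting -/
lemma split_of_VE {Q E N : ModuleCat.{u} A} (h : Sx Q E N) (hQ : Module.Projective A Q)
    (hN : VE N 1) : Nonempty (E ≃ₗ[A] (ModuleCat.of A (N × Q))) := by
  obtain ⟨f, g, h⟩ := h
  obtain ⟨b, hb⟩ := extend_of_VE h hN Q hQ LinearMap.id
  obtain ⟨h1, h2, h3⟩ := h
  have hbf : ∀ q, b (f q) = q := fun q => congrArg (fun t => t q) hb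
  refine ⟨LinearEquiv.ofBijective (g.prod b) ⟨?_, ?_⟩⟩
  · rw [← LinearMap.ker_eq_bot, LinearMap.ker_eq_bot']
    intro e he
    have a1 : g e = 0 := congrArg Prod.fst he
    have a2 : b e = 0 := congrArg Prod.snd he
    obtain ⟨q, rfl⟩ := (h3 e).1 a1
    rw [hbf] at a2
    rw [a2, map_zero]
  · rintro ⟨n, q⟩
    obtain ⟨e, rfl⟩ := h2 n
    refine ⟨e + f (q - b e), ?_⟩
    have := h3.apply_apply_eq_zero (q - b e)
    ext
    · show g (e + f (q - b e)) = g e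
      rw [map_add, this, add_zero]
    · show b (e + f (q - b e)) = q
      rw [map_add, hbf]
      abel

/-- A class of modules closed under cosyzygies and with vanishing Ext to projectives. -/
def GoodClass (S : ModuleCat.{u} A → Prop) : Prop :=
  ∀ M, S M → (∀ i, VE M (i+1)) ∧
    ∃ Q M' : ModuleCat.{u} A, Module.Projective A Q ∧ Sx M Q M' ∧ S M'

/-- Coinductive form of Gorenstein projectivity. -/
def GPc (M : ModuleCat.{u} A) : Prop := ∃ S, GoodClass S ∧ S M

lemma GPc.VE {M : ModuleCat.{u} A} (h : GPc M) (i : ℕ) : VE M (i+1) := by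
  obtain ⟨S, hS, hM⟩ := h
  exact (hS M hM).1 i

lemma GPc.cosyz {M : ModuleCat.{u} A} (h : GPc M) :
    ∃ Q M' : ModuleCat.{u} A, Module.Projective A Q ∧ Sx M Q M' ∧ GPc M' := by
  obtain ⟨S, hS, hM⟩ := h
  obtain ⟨Q, M', hQ, h1, h2⟩ := (hS M hM).2
  exact ⟨Q, M', hQ, h1, S, hS, h2⟩

lemma GPc.syz {K P M : ModuleCat.{u} A} (h : GPc M) (hP : Module.Projective A P)
    (hx : Sx K P M) : GPc K := by
  refine ⟨fun N => GPc N ∨ N = K, ?_, Or.inr rfl⟩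
  rintro N (hN | rfl)
  · obtain ⟨Q, M', hQ, h1, h2⟩ := hN.cosyz
    exact ⟨hN.VE, Q, M', hQ, h1, Or.inl h2⟩
  · exact ⟨fun i => VE_left hx (VE_proj hP i) (h.VE (i+1)), P, M, hP, hx, Or.inl h⟩

lemma projective_subsingleton (M : ModuleCat.{u} A) [Subsingleton M] : Module.Projective A M :=
  Module.Projective.of_free

lemma GPc_proj {M : ModuleCat.{u} A} (h : Module.Projective A M) : GPc M := by
  refine ⟨fun N => Module.Projective A N, ?_, h⟩
  intro N hN
  refine ⟨VE_proj hN, N, ModuleCat.of A PUnit, hN, Sx_of_equiv (LinearEquiv.refl A N), ?_⟩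
  have : Subsingleton (ModuleCat.of A PUnit.{u+1}) := inferInstanceAs (Subsingleton PUnit)
  exact projective_subsingleton _

lemma GPc.ext {X Y Z : ModuleCat.{u} A} (h : Sx X Y Z) (hX : GPc X) (hZ : GPc Z) : GPc Y := by
  refine ⟨fun E => ∃ M N : ModuleCat.{u} A, Sx M E N ∧ GPc M ∧ GPc N, ?_, X, Z, h, hX, hZ⟩
  rintro E ⟨M, N, hE, hM, hN⟩
  refine ⟨fun i => VE_mid hE (hM.VE i) (hN.VE i), ?_⟩
  obtain ⟨QM, M', hQM, hM1, hM2⟩ := hM.cosyz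
  obtain ⟨QN, N', hQN, hN1, hN2⟩ := hN.cosyz
  obtain ⟨E1, hE1, hE2⟩ := Sx_pushout hE hM1
  obtain ⟨e⟩ := split_of_VE hE1 hQM (hN.VE 0)
  have h2 : Sx E1 (ModuleCat.of A (QN × QM)) N' := Sx_iso_left (Sx_add hN1 QM) e
  obtain ⟨D, hD1, hD2⟩ := Sx_third hE2 h2
  refine ⟨_, D, ?_, hD1, M', N', hD2, hM2, hN2⟩
  exact inferInstanceAs (Module.Projective A (QN × QM))

lemma GPc.iso {X Y : ModuleCat.{u} A} (h : GPc X) (e : X ≃ₗ[A] Y) : GPc Y := by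
  refine GPc.ext (Sx_of_equiv e) h (GPc_proj ?_)
  have : Subsingleton (ModuleCat.of A PUnit.{u+1}) := inferInstanceAs (Subsingleton PUnit)
  exact projective_subsingleton _

/-- cocycles -/
abbrev Zc (X : Cplx A) (n : ℤ) : ModuleCat.{u} A :=
  ModuleCat.of A (LinearMap.ker (X.d n (n+1)).hom)

/-- elementwise exactness -/
def ElExact (X : Cplx A) : Prop :=
  ∀ (n : ℤ) (x : X.X (n+1)), (X.d (n+1) (n+1+1)).hom x = 0 → ∃ y, (X.d n (n+1)).hom y = x

/-- differential to cocycles -/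
def dZ (X : Cplx A) (n : ℤ) : X.X n →ₗ[A] Zc X (n+1) :=
  (X.d n (n+1)).hom.codRestrict _ (fun x => by
    have := X.d_comp_d n (n+1) (n+1+1)
    exact congrArg (fun t => t.hom x) this)

lemma Zc_SxM (X : Cplx A) (h : ElExact X) (n : ℤ) :
    SxM (X := Zc X n) (Submodule.subtype _) (dZ X n) := by
  refine ⟨Submodule.subtype_injective _, ?_, ?_⟩
  · rintro ⟨x, hx⟩
    obtain ⟨y, hy⟩ := h n x hx
    exact ⟨y, Subtype.ext hy⟩
  · intro x
    constructor
    · intro hx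
      exact ⟨⟨x, congrArg Subtype.val hx⟩, rfl⟩
    · rintro ⟨⟨x, hx⟩, rfl⟩
      exact Subtype.ext hx

lemma elExact_of_acyclic (X : Cplx A) (h : IsAcyclicComplex A X) : ElExact X := by
  intro n x hx
  have h1 := h (n+1)
  rw [HomologicalComplex.exactAt_iff' X n (n+1) (n+1+1) (by simp) (by simp)] at h1
  rw [ShortComplex.moduleCat_exact_iff] at h1
  exact h1 x hx

lemma acyclic_of_elExact (X : Cplx A) (h : ElExact X) : IsAcyclicComplex A X := by
  intro m
  obtain ⟨n, rfl⟩ : ∃ n, m = n + 1 := ⟨m - 1, by omega⟩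
  rw [HomologicalComplex.exactAt_iff' X n (n+1) (n+1+1) (by simp) (by simp)]
  rw [ShortComplex.moduleCat_exact_iff]
  exact h n

lemma GPc_of_GP {G : ModuleCat.{u} A} (h : IsGorensteinProjective A G) : GPc G := by
  obtain ⟨P, hac, hproj, hhom, ⟨e⟩⟩ := h
  have hel := elExact_of_acyclic P hac
  have hV : ∀ i n, VE (Zc P n) (i+1) := by
    intro i
    induction i with
    | zero =>
      intro m
      obtain ⟨n, rfl⟩ : ∃ n, m = n + 1 + 1 := ⟨m - 2, by omega⟩
      refine VE_of_extend (Zc_SxM P hel (n+1)) (VE_proj (hproj _) 0) fun Q hQ a => ?_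
      have hh := hhom Q hQ n (ModuleCat.ofHom (a ∘ₗ dZ P n)) (by
        ext x
        have h0 : dZ P n ((P.d (n-1) n).hom x) = 0 := by
          apply Subtype.ext
          exact congrArg (fun t => t.hom x) (P.d_comp_d (n-1) n (n+1))
        show a (dZ P n ((P.d (n-1) n).hom x)) = 0
        rw [h0, map_zero])
      obtain ⟨g, hg⟩ := hh
      refine ⟨g.hom, ?_⟩
      ext z
      obtain ⟨y, hy⟩ := (Zc_SxM P hel n).2.1 z
      have := congrArg (fun t => t.hom y) hg
      rw [← hy]
      exact this
    | succ i ih =>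
      intro m
      obtain ⟨n, rfl⟩ : ∃ n, m = n + 1 := ⟨m - 1, by omega⟩
      exact VE_right ⟨_, _, Zc_SxM P hel n⟩ (ih n) (VE_proj (hproj n) (i+1))
  have h0 : GPc (Zc P 0) := by
    refine ⟨fun M => ∃ n, M = Zc P n, ?_, 0, rfl⟩
    rintro _ ⟨n, rfl⟩
    exact ⟨fun i => hV i n, P.X n, Zc P (n+1), hproj n, ⟨_, _, Zc_SxM P hel n⟩, n+1, rfl⟩
  exact h0.iso ((e ≪≫ ModuleCat.kernelIsoKer (P.d 0 1)).symm.toLinearEquiv)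

lemma int_seq {T : Type*} (R : T → T → Prop) (h1 : ∀ t, ∃ t', R t t') (h2 : ∀ t, ∃ t', R t' t)
    (t0 : T) : ∃ s : ℤ → T, s 0 = t0 ∧ ∀ n, R (s n) (s (n+1)) := by
  choose nx hnx using h1
  choose pv hpv using h2
  refine ⟨fun n => Int.casesOn n (fun k => nx^[k] t0) (fun k => pv^[k+1] t0), rfl, ?_⟩
  rintro (k | k)
  · show R (nx^[k] t0) (nx^[k+1] t0)
    rw [Function.iterate_succ_apply']
    exact hnx _
  · cases k with
    | zero => exact hpv t0
    | succ k =>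
      show R (pv^[k+1+1] t0) (pv^[k+1] t0)
      rw [Function.iterate_succ_apply' _ (k+1)]
      exact hpv _

lemma exists_proj_cover (M : ModuleCat.{u} A) : ∃ K P : ModuleCat.{u} A,
    Module.Projective A P ∧ Sx K P M := by
  let p : (M →₀ A) →ₗ[A] M := Finsupp.linearCombination A id
  refine ⟨ModuleCat.of A (LinearMap.ker p), ModuleCat.of A (M →₀ A),
    inferInstanceAs (Module.Projective A (M →₀ A)), Submodule.subtype _, p,
    Submodule.subtype_injective _, Finsupp.linearCombination_id_surjective A M, ?_⟩
  exact LinearMap.exact_subtype_ker_map p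

lemma GP_of_GPc {G : ModuleCat.{u} A} (h : GPc G) : IsGorensteinProjective A G := by
  obtain ⟨s, hs0, hs⟩ := int_seq (T := {M : ModuleCat.{u} A // GPc M})
    (fun M N => ∃ Q : ModuleCat.{u} A, Module.Projective A Q ∧ Sx M.1 Q N.1)
    (by
      rintro ⟨M, hM⟩
      obtain ⟨Q, M', hQ, h1, h2⟩ := hM.cosyz
      exact ⟨⟨M', h2⟩, Q, hQ, h1⟩)
    (by
      rintro ⟨M, hM⟩
      obtain ⟨K, P, hP, hx⟩ := exists_proj_cover M
      exact ⟨⟨K, hM.syz hP hx⟩, P, hP, hx⟩) ⟨G, h⟩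
  choose Q hQ f g hfg using hs
  let P : Cplx A := CochainComplex.of Q
    (fun n => ModuleCat.ofHom (f (n+1) ∘ₗ g n)) (by
      intro n
      ext x
      show f (n+1+1) (g (n+1) (f (n+1) (g n x))) = 0
      rw [(hfg (n+1)).2.2.apply_apply_eq_zero, map_zero])
  have hd : ∀ n (x : Q n), (P.d n (n+1)).hom x = f (n+1) (g n x) := by
    intro n x
    have : P.d n (n+1) = ModuleCat.ofHom (f (n+1) ∘ₗ g n) := 
      CochainComplex.of_d Q (fun n => ModuleCat.ofHom (f (n+1) ∘ₗ g n)) n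
    rw [this]
    rfl
  have hker : ∀ n (x : Q n), (P.d n (n+1)).hom x = 0 → ∃ y, f n y = x := by
    intro n x hx
    rw [hd] at hx
    have := (hfg (n+1)).1 (hx.trans (map_zero _).symm)
    exact ((hfg n).2.2 x).1 this
  refine ⟨P, acyclic_of_elExact P ?_, hQ, ?_, ?_⟩
  · intro n x hx
    obtain ⟨y, rfl⟩ := hker (n+1) x hx
    obtain ⟨z, rfl⟩ := (hfg n).2.1 y
    exact ⟨z, hd n z⟩
  · intro J hJ m a ha
    obtain ⟨n, rfl⟩ : ∃ n, m = n + 1 := ⟨m - 1, by omega⟩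
    have e : n + 1 - 1 = n := by omega
    rw [e] at ha
    have ha' : ∀ y, a.hom (f (n+1) y) = 0 := by
      intro y
      obtain ⟨z, rfl⟩ := (hfg n).2.1 y
      rw [← hd]
      exact congrArg (fun t => t.hom z) ha
    obtain ⟨-, hg2, hg3⟩ := hfg (n+1)
    have hK : LinearMap.ker (g (n+1)) ≤ LinearMap.ker a.hom := by
      intro y hy
      obtain ⟨x, rfl⟩ := (hg3 y).1 hy
      exact ha' x
    let b := (LinearMap.ker (g (n+1))).liftQ _ hK ∘ₗ
      ((g (n+1)).quotKerEquivOfSurjective hg2).symm.toLinearMap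
    have hb : ∀ y, b (g (n+1) y) = a.hom y := by
      intro y
      have : ((g (n+1)).quotKerEquivOfSurjective hg2).symm (g (n+1) y) =
          Submodule.Quotient.mk y := by
        rw [LinearEquiv.symm_apply_eq]
        rfl
      simp only [b, LinearMap.comp_apply, LinearEquiv.coe_coe, this]
      rfl
    obtain ⟨c, hc⟩ := extend_of_VE (hfg (n+1+1)) ((s (n+1+1+1)).2.VE 0) J hJ b
    refine ⟨ModuleCat.ofHom c, ?_⟩
    ext x
    show c ((P.d (n+1) (n+1+1)).hom x) = a.hom x
    rw [hd, ← hb]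
    exact congrArg (fun t => t (g (n+1) x)) hc
  · have hr : LinearMap.range (f 0) = LinearMap.ker (P.d 0 1).hom := by
      ext x
      constructor
      · rintro ⟨y, rfl⟩
        show (P.d 0 (0+1)).hom (f 0 y) = 0
        rw [hd, (hfg 0).2.2.apply_apply_eq_zero, map_zero]
      · intro hx
        exact hker 0 x hx
    let e1 : (s 0).1 ≃ₗ[A] LinearMap.ker (P.d 0 1).hom :=
      (LinearEquiv.ofInjective (f 0) (hfg 0).1).trans (LinearEquiv.ofEq _ _ hr)
    have e0 : (s 0).1 = G := by rw [hs0]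
    exact ⟨eqToIso e0.symm ≪≫ e1.toModuleIso ≪≫ (ModuleCat.kernelIsoKer (P.d 0 1)).symm⟩

lemma VE_of_projDimLE (s : ℕ) : ∀ (M : ModuleCat.{u} A), ProjDimLE A s M → ∀ i, VE M (s+i+1) := by
  induction s with
  | zero =>
    intro M hM i
    exact VE_proj hM _
  | succ s ih =>
    rintro M ⟨K, P, i, p, hP, h1, h2, h3, hK⟩ j
    have := VE_right (X := K) (Y := P) (Z := M) ⟨i.hom, p.hom, h1, h2, h3⟩ (ih K hK j) (VE_proj hP _)
    have e : s + 1 + j + 1 = s + j + 1 + 1 := by omega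
    rw [e]
    exact this

lemma elExact_of_GPAcyclic (X : Cplx A) (h : GPAcyclic A X) : ElExact X := by
  intro n x hx
  have hA : IsGorensteinProjective A (ModuleCat.of A A) :=
    GP_of_GPc (GPc_proj (inferInstanceAs (Module.Projective A A)))
  have h1 := h _ hA (n+1) (ModuleCat.ofHom (LinearMap.toSpanSingleton A _ x)) (by
    ext
    show (X.d (n+1) (n+1+1)).hom ((1 : A) • x) = 0
    rw [one_smul, hx])
  have e : n + 1 - 1 = n := by omega
  rw [e] at h1
  obtain ⟨g, hg⟩ := h1
  refine ⟨g.hom (1 : A), ?_⟩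
  have := congrArg (fun t => t.hom (1 : A)) hg
  refine Eq.trans this ?_
  show (1 : A) • x = x
  exact one_smul _ _

lemma lift_of_GPAcyclic (X : Cplx A) (h : GPAcyclic A X) {W : ModuleCat.{u} A} (n : ℤ)
    (hG : IsGorensteinProjective A (ModuleCat.of A (Zc X (n+1) × W))) :
    ∃ σ : Zc X (n+1) →ₗ[A] X.X n, ∀ z, (X.d n (n+1)).hom (σ z) = z.1 := by
  have h1 := h _ hG (n+1) (ModuleCat.ofHom
    ((Submodule.subtype (LinearMap.ker (X.d (n+1) (n+1+1)).hom)) ∘ₗ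
      LinearMap.fst A (Zc X (n+1)) W)) (by
    refine ModuleCat.hom_ext (LinearMap.ext fun x => ?_)
    exact x.1.2)
  have e : n + 1 - 1 = n := by omega
  rw [e] at h1
  obtain ⟨g, hg⟩ := h1
  refine ⟨g.hom ∘ₗ LinearMap.inl A (Zc X (n+1)) W, fun z => ?_⟩
  exact congrArg (fun t => t.hom ((z, 0) : Zc X (n+1) × W)) hg

lemma contractible_of_lift (X : Cplx A)
    (h : ∀ n, ∃ σ : Zc X (n+1) →ₗ[A] X.X n, ∀ z, (X.d n (n+1)).hom (σ z) = z.1) :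
    Contractible A X := by
  choose σ hσ using h
  have hr : ∀ n, ∃ r : X.X (n+1) →ₗ[A] Zc X (n+1), ∀ x,
      (r x).1 = x - σ (n+1) (dZ X (n+1) x) := by
    intro n
    refine ⟨LinearMap.codRestrict (LinearMap.ker (X.d (n+1) (n+1+1)).hom)
      (LinearMap.id - σ (n+1) ∘ₗ dZ X (n+1)) ?_, fun x => rfl⟩
    intro x
    rw [LinearMap.mem_ker]
    show (X.d (n+1) (n+1+1)).hom (x - σ (n+1) (dZ X (n+1) x)) = 0
    rw [map_sub, hσ]
    exact sub_self _
  choose r hr using hr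
  have key : ∀ n (x : X.X (n+1)), (σ (n+1) (r (n+1) ((X.d (n+1) (n+1+1)).hom x))) +
      (X.d n (n+1)).hom (σ n (r n x)) = x := by
    intro n x
    have e : r (n+1) ((X.d (n+1) (n+1+1)).hom x) = dZ X (n+1) x := by
      apply Subtype.ext
      rw [hr]
      have : dZ X (n+1+1) ((X.d (n+1) (n+1+1)).hom x) = 0 := by
        apply Subtype.ext
        exact congrArg (fun t => t.hom x) (X.d_comp_d (n+1) (n+1+1) (n+1+1+1))
      rw [this, map_zero, sub_zero]
      rfl
    rw [e, hσ, hr]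
    abel
  let hm : ∀ i j, (ComplexShape.up ℤ).Rel j i → (X.X i ⟶ X.X j) := fun i j hij =>
    eqToHom (by rw [← (show j + 1 = i from hij)]) ≫ ModuleCat.ofHom (σ j ∘ₗ r j)
  have hm1 : ∀ n h, hm (n+1) n h = ModuleCat.ofHom (σ n ∘ₗ r n) := by
    intro n h
    simp [hm]
  refine ⟨(Homotopy.ofEq ?_).trans (Homotopy.nullHomotopy' hm)⟩
  ext m : 1
  obtain ⟨n, rfl⟩ : ∃ n, m = n + 1 := ⟨m - 1, by omega⟩
  have r1 : (ComplexShape.up ℤ).Rel n (n+1) := rfl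
  have r2 : (ComplexShape.up ℤ).Rel (n+1) (n+1+1) := rfl
  rw [Homotopy.nullHomotopicMap'_f r1 r2, hm1 (n+1) r2, hm1 n r1]
  ext x
  exact (key n x).symm

lemma int_ind (p : ℤ → Prop) (a : ℤ) (h0 : ∀ n < a, p n) (hs : ∀ n, p n → p (n+1)) (n : ℤ) :
    p n := by
  by_cases h : n < a
  · exact h0 n h
  · exact Int.leInduction (m := a - 1) (motive := fun n _ => p n) (h0 _ (by omega))
      (fun k _ hk => hs k hk) n (by omega)

end Helpers

/-- If `FPD(A) < ∞` then every bounded below GP-acyclic complex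
of Gorenstein-projective modules is contractible. -/
theorem FPD_implies_contractible (hFPD : FPDFinite A) (X : Cplx A)
    (hb : BoundedBelow A X) (hacyc : GPAcyclic A X)
    (hterms : ∀ n : ℤ, IsGorensteinProjective A (X.X n)) :
    Contractible A X := by
  obtain ⟨s, hs⟩ := hFPD
  obtain ⟨a, ha⟩ := hb
  have hel := elExact_of_GPAcyclic X hacyc
  have hX : ∀ n, GPc (X.X n) := fun n => GPc_of_GP (hterms n)
  have hZ : ∀ n, Sx (Zc X n) (X.X n) (Zc X (n+1)) := fun n => ⟨_, _, Zc_SxM X hel n⟩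
  have hzero : ∀ n < a, Subsingleton (Zc X n) := by
    intro n hn
    have := ModuleCat.subsingleton_of_isZero (ha n hn)
    exact inferInstanceAs (Subsingleton (LinearMap.ker (X.d n (n+1)).hom))
  have hH : ∀ n, ∃ (H G : ModuleCat.{u} A) (k : ℕ), ProjDimLE A k H ∧ GPc G ∧ Sx (Zc X n) H G := by
    refine int_ind _ a ?_ ?_
    · intro n hn
      have := hzero n hn
      have : Subsingleton (ModuleCat.of A PUnit.{u+1}) := inferInstanceAs (Subsingleton PUnit)
      exact ⟨Zc X n, ModuleCat.of A PUnit, 0, projective_subsingleton _,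
        GPc_proj (projective_subsingleton _), Sx_of_equiv (LinearEquiv.refl A _)⟩
    · rintro n ⟨H, G, k, hk, hG, hx⟩
      obtain ⟨E, hE1, hE2⟩ := Sx_pushout (hZ n) hx
      obtain ⟨Q, E', hQ, hE3, hE'⟩ := (GPc.ext hE2 (hX n) hG).cosyz
      obtain ⟨D, ⟨f, g, h1, h2, h3⟩, hD2⟩ := Sx_third hE1 hE3
      exact ⟨D, E', k+1, ⟨H, Q, ModuleCat.ofHom f, ModuleCat.ofHom g, hQ, h1, h2, h3, hk⟩, hE', hD2⟩
  have hV : ∀ n, VE (Zc X n) (s+1) := by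
    intro n
    obtain ⟨H, G, k, hk, hG, hx⟩ := hH n
    exact VE_left hx (VE_of_projDimLE s H (hs H ⟨k, hk⟩) 0) (hG.VE _)
  have hV1 : ∀ n, VE (Zc X n) 1 := by
    clear hs hH
    induction s with
    | zero => exact hV
    | succ s ih => exact ih fun n => VE_left (hZ n) ((hX n).VE s) (hV (n+1))
  have hW : ∀ n, ∃ W : ModuleCat.{u} A, Module.Projective A W ∧
      GPc (ModuleCat.of A (Zc X n × W)) := by
    refine int_ind _ a ?_ ?_
    · intro n hn
      have := hzero n hn
      have hp := projective_subsingleton (Zc X n)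
      exact ⟨Zc X n, hp, GPc.ext (Sx_prod _ _) (GPc_proj hp) (GPc_proj hp)⟩
    · rintro n ⟨W, hW, hG⟩
      obtain ⟨Q, G', hQ, h1, h2⟩ := hG.cosyz
      obtain ⟨E, hE1, hE2⟩ := Sx_pushout (Sx_add (hZ n) W) h1
      have hE : GPc E := GPc.ext hE2 (GPc.ext (Sx_prod _ _) (hX n) (GPc_proj hW)) h2
      obtain ⟨e⟩ := split_of_VE hE1 hQ (hV1 (n+1))
      exact ⟨Q, hQ, hE.iso e⟩
  refine contractible_of_lift X fun n => ?_
  obtain ⟨W, hW, hG⟩ := hW (n+1)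
  exact lift_of_GPAcyclic X hacyc n (GP_of_GPc hG)
end

section
/- Let A be a ring, and let X be a bounded acyclic cochain complex of A-modules such that for every n ∈ ℤ the A-module Xⁿ has finite projective dimension. Then X is GP-acyclic. -/
open CategoryTheory CategoryTheory.Limits

universe u

variable (A : Type u) [Ring A]

/-- Index-flexible form of `HomToAcyclic`. -/
def HTA (P : Cplx A) (J : ModuleCat.{u} A) : Prop :=
  ∀ (i j k : ℤ), i + 1 = j → j + 1 = k → ∀ f : P.X j ⟶ J, P.d i j ≫ f = 0 →
    ∃ g : P.X k ⟶ J, P.d j k ≫ g = f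

theorem HTA_of (P : Cplx A) (J : ModuleCat.{u} A) (h : HomToAcyclic A P J) : HTA A P J := by
  intro i j k hi hk f hf
  obtain rfl : i = j - 1 := by omega
  subst hk
  exact h j f hf

theorem HTA_ses (P : Cplx A) (hP : ∀ n : ℤ, Projective (P.X n)) {K E M : ModuleCat.{u} A}
    (i : K ⟶ E) (p : E ⟶ M) (w : i ≫ p = 0) (hS : (ShortComplex.mk i p w).ShortExact)
    (hK : HTA A P K) (hE : HTA A P E) : HTA A P M := by
  have := hS.mono_f
  have := hS.epi_g
  dsimp at *
  intro a b c ha hc f hf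
  have := hP b
  have e1 : Projective.factorThru f p ≫ p = f := Projective.factorThru_comp f p
  generalize Projective.factorThru f p = f' at e1
  have e2 : (P.d a b ≫ f') ≫ p = 0 := by rw [Category.assoc, e1, hf]
  obtain ⟨h, hh⟩ : ∃ h : P.X a ⟶ K, h ≫ i = P.d a b ≫ f' :=
    ⟨hS.exact.lift _ e2, hS.exact.lift_f _ e2⟩
  obtain ⟨k, hk⟩ := hK (a - 1) a b (by omega) ha h (by
    rw [← cancel_mono i, Category.assoc, hh, zero_comp, ← Category.assoc, P.d_comp_d, zero_comp])
  obtain ⟨g, hg⟩ := hE a b c ha hc (f' - k ≫ i) (by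
    rw [Preadditive.comp_sub, ← Category.assoc, hk, hh, sub_self])
  refine ⟨g ≫ p, ?_⟩
  rw [← Category.assoc, hg, Preadditive.sub_comp, e1, Category.assoc, w, comp_zero, sub_zero]

theorem HTA_pd (P : Cplx A) (hP : ∀ n : ℤ, Projective (P.X n))
    (hQ : ∀ Q : ModuleCat.{u} A, Module.Projective A Q → HomToAcyclic A P Q) (n : ℕ) :
    ∀ M : ModuleCat.{u} A, ProjDimLE A n M → HTA A P M := by
  induction n with
  | zero => intro M hM; exact HTA_of A P M (hQ M hM)
  | succ n ih =>
    rintro M ⟨K, Q, i, p, hpq, hi, hp, hex, hK⟩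
    have w : i ≫ p = 0 := by
      ext x
      exact hex.apply_apply_eq_zero x
    refine HTA_ses A P hP i p w ?_ (ih K hK) (HTA_of A P Q (hQ Q hpq))
    have : Mono i := (ModuleCat.mono_iff_injective i).2 hi
    have : Epi p := (ModuleCat.epi_iff_surjective p).2 hp
    exact { exact := (ShortComplex.ShortExact.moduleCat_exact_iff_function_exact _).2 hex }

theorem lift_of_HTA (P : Cplx A) (hP : ∀ n : ℤ, Projective (P.X n)) (hac : IsAcyclicComplex A P)
    {G K E M : ModuleCat.{u} A} (e : G ≅ kernel (P.d 0 1))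
    (i : K ⟶ E) (p : E ⟶ M) (w : i ≫ p = 0) (hS : (ShortComplex.mk i p w).ShortExact)
    (hK : HTA A P K) (f : G ⟶ M) : ∃ g : G ⟶ E, g ≫ p = f := by
  have := hS.mono_f
  have := hS.epi_g
  dsimp at *
  have ex0 := (P.exactAt_iff' (-1) 0 1 (by simp) (by simp)).1 (hac 0)
  have ex1 := (P.exactAt_iff' (-2) (-1) 0 (by simp) (by simp)).1 (hac (-1))
  let q : P.X (-1) ⟶ G := kernel.lift (P.d 0 1) (P.d (-1) 0) (by simp) ≫ e.inv
  have hqe : q ≫ e.hom ≫ kernel.ι (P.d 0 1) = P.d (-1) 0 := by simp [q]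
  have : Epi (kernel.lift (P.d 0 1) (P.d (-1) 0) (by simp)) :=
    (ShortComplex.exact_iff_epi_kernel_lift _).1 ex0
  have : Epi q := epi_comp _ _
  have hq0 : P.d (-2) (-1) ≫ q = 0 := by
    rw [← cancel_mono (e.hom ≫ kernel.ι (P.d 0 1)), Category.assoc, hqe]; simp
  have hqex : (ShortComplex.mk (P.d (-2) (-1)) q hq0).Exact := by
    let φ : ShortComplex.mk (P.d (-2) (-1)) q hq0 ⟶
        ShortComplex.mk (P.d (-2) (-1)) (P.d (-1) 0) (by simp) :=
      { τ₁ := 𝟙 _, τ₂ := 𝟙 _, τ₃ := e.hom ≫ kernel.ι (P.d 0 1), comm₁₂ := by simp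
        comm₂₃ := by simpa using hqe.symm }
    have : Epi φ.τ₁ := inferInstanceAs (Epi (𝟙 _))
    have : IsIso φ.τ₂ := inferInstanceAs (IsIso (𝟙 _))
    have : Mono φ.τ₃ := inferInstanceAs (Mono (e.hom ≫ kernel.ι (P.d 0 1)))
    exact (ShortComplex.exact_iff_of_epi_of_isIso_of_mono φ).2 ex1
  clear_value q
  have := hP (-1)
  have e1 : Projective.factorThru (q ≫ f) p ≫ p = q ≫ f := Projective.factorThru_comp _ p
  generalize Projective.factorThru (q ≫ f) p = f' at e1
  have e2 : (P.d (-2) (-1) ≫ f') ≫ p = 0 := by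
    rw [Category.assoc, e1, ← Category.assoc, hq0, zero_comp]
  obtain ⟨h, hh⟩ : ∃ h : P.X (-2) ⟶ K, h ≫ i = P.d (-2) (-1) ≫ f' :=
    ⟨hS.exact.lift _ e2, hS.exact.lift_f _ e2⟩
  obtain ⟨k, hk⟩ := hK (-3) (-2) (-1) (by omega) (by omega) h (by
    rw [← cancel_mono i, Category.assoc, hh, zero_comp, ← Category.assoc, P.d_comp_d, zero_comp])
  have e3 : P.d (-2) (-1) ≫ (f' - k ≫ i) = 0 := by
    rw [Preadditive.comp_sub, ← Category.assoc, hk, hh, sub_self]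
  obtain ⟨g, hg⟩ : ∃ g : G ⟶ E, q ≫ g = f' - k ≫ i :=
    ⟨hqex.desc _ e3, hqex.g_desc _ e3⟩
  refine ⟨g, ?_⟩
  rw [← cancel_epi q, ← Category.assoc, hg, Preadditive.sub_comp, e1, Category.assoc, w,
    comp_zero, sub_zero]

theorem cyc_ses (X : Cplx A) (hac : IsAcyclicComplex A X) (a b c : ℤ) (ha : a + 1 = b)
    (hb : b + 1 = c) :
    (ShortComplex.mk (kernel.ι (X.d a b)) (kernel.lift (X.d b c) (X.d a b) (by simp))
      (by rw [← cancel_mono (kernel.ι (X.d b c))]; simp)).ShortExact := by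
  have ex0 := (X.exactAt_iff' a b c (by simp; omega) (by simp; omega)).1 (hac b)
  have : Epi (kernel.lift (X.d b c) (X.d a b) (by simp)) :=
    (ShortComplex.exact_iff_epi_kernel_lift _).1 ex0
  refine { exact := ?_ }
  let φ : ShortComplex.mk (kernel.ι (X.d a b)) (kernel.lift (X.d b c) (X.d a b) (by simp))
      (by rw [← cancel_mono (kernel.ι (X.d b c))]; simp) ⟶
      ShortComplex.mk (kernel.ι (X.d a b)) (X.d a b) (by simp) :=
    { τ₁ := 𝟙 _, τ₂ := 𝟙 _, τ₃ := kernel.ι (X.d b c), comm₁₂ := by simp, comm₂₃ := by simp }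
  have : Epi φ.τ₁ := inferInstanceAs (Epi (𝟙 _))
  have : IsIso φ.τ₂ := inferInstanceAs (IsIso (𝟙 _))
  have : Mono φ.τ₃ := inferInstanceAs (Mono (kernel.ι (X.d b c)))
  exact (ShortComplex.exact_iff_of_epi_of_isIso_of_mono φ).2 (ShortComplex.exact_kernel _)

theorem HTA_cyc (P : Cplx A) (hP : ∀ n : ℤ, Projective (P.X n)) (X : Cplx A)
    (hac : IsAcyclicComplex A X) (hX : ∀ n, HTA A P (X.X n)) (a : ℤ)
    (ha : ∀ n < a, IsZero (X.X n)) (n : ℤ) : HTA A P (kernel (X.d n (n + 1))) := by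
  have base : ∀ n < a, HTA A P (kernel (X.d n (n + 1))) := by
    intro n hn i j k _ _ f _
    refine ⟨0, ?_⟩
    rw [← cancel_mono (kernel.ι _)]
    exact (ha n hn).eq_of_tgt _ _
  have step : ∀ m : ℕ, HTA A P (kernel (X.d (a - 1 + m) (a - 1 + m + 1))) := by
    intro m
    induction m with
    | zero => exact base _ (by simp)
    | succ m ih =>
      have := HTA_ses A P hP _ _ _ (cyc_ses A X hac _ _ _ rfl rfl) ih (hX _)
      have e : a - 1 + ((m + 1 : ℕ) : ℤ) = a - 1 + m + 1 := by push_cast; ring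
      rw [e]
      exact this
  by_cases hn : n < a
  · exact base n hn
  · have := step (n - (a - 1)).toNat
    have e : a - 1 + ((n - (a - 1)).toNat : ℤ) = n := by omega
    rwa [e] at this

/-- A bounded acyclic complex all of whose terms have finite
projective dimension is GP-acyclic. -/
theorem bounded_acyclic_finite_projdim_GPAcyclic (X : Cplx A)
    (hb : BoundedComplex A X) (hacyc : IsAcyclicComplex A X)
    (hfpd : ∀ n : ℤ, ∃ k : ℕ, ProjDimLE A k (X.X n)) :
    GPAcyclic A X := by
  obtain ⟨a, b, hab⟩ := hb
  rintro G ⟨P, hPac, hPp, hQ, ⟨e⟩⟩ n f hf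
  have hP : ∀ n : ℤ, Projective (P.X n) := fun n =>
    (IsProjective.iff_projective (P.X n)).1 (hPp n)
  have hX : ∀ n, HTA A P (X.X n) := fun n => by
    obtain ⟨k, hk⟩ := hfpd n
    exact HTA_pd A P hP hQ k _ hk
  have hZ := HTA_cyc A P hP X hacyc hX a (fun n hn => hab n (Or.inl hn)) (n - 1)
  obtain ⟨m, rfl⟩ : ∃ m, n = m + 1 := ⟨n - 1, by ring⟩
  have em : m + 1 - 1 = m := by ring
  rw [em] at hZ ⊢
  obtain ⟨g, hg⟩ := lift_of_HTA A P hP hPac e _ _ _ (cyc_ses A X hacyc m (m + 1) (m + 1 + 1) rfl rfl)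
    hZ (kernel.lift _ f hf)
  refine ⟨g, ?_⟩
  have := congrArg (· ≫ kernel.ι _) hg
  simpa using this
end

section
/- Let A be a ring. Then every acyclic bounded below cochain complex of projective A-modules is GP-acyclic. -/
open CategoryTheory CategoryTheory.Limits

universe u

variable (A : Type u) [Ring A]

theorem gp_lift_aux (P X : Cplx A) 
    (hP : ∀ n : ℤ, Module.Projective A (P.X n))
    (hQ : ∀ Q : ModuleCat.{u} A, Module.Projective A Q → HomToAcyclic A P Q)
    (hacyc : IsAcyclicComplex A X)
    (hproj : ∀ n : ℤ, Module.Projective A (X.X n))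
    (a : ℤ) (ha : ∀ n < a, IsZero (X.X n)) (m : ℕ) :
    ∀ (n : ℤ), n < a + m → ∀ (k : ℤ) (h : P.X k ⟶ X.X n), P.d (k - 1) k ≫ h = 0 →
      h ≫ X.d n (n + 1) = 0 →
      ∃ g : P.X k ⟶ X.X (n - 1), P.d (k - 1) k ≫ g = 0 ∧ g ≫ X.d (n - 1) n = h := by
  induction m with
  | zero =>
    intro n hn k h _ _
    exact ⟨0, by simp, (ha n (by simpa using hn)).eq_of_tgt _ _⟩
  | succ m ih =>
    intro n hn k h h1 h2
    have := (IsProjective.iff_projective (R := A) (P.X k)).1 (hP k)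
    have hex := (X.exactAt_iff' (n - 1) n (n + 1) (by simp) (by simp)).1 (hacyc n)
    obtain ⟨g0, hg0⟩ : ∃ g0 : P.X k ⟶ X.X (n - 1), g0 ≫ X.d (n - 1) n = h :=
      ⟨hex.liftFromProjective h h2, hex.liftFromProjective_comp h h2⟩
    have e : n - 1 + 1 = n := by omega
    obtain ⟨g1, hg1, hg1'⟩ := ih (n - 1) (by push_cast at hn; omega) (k - 1)
      (P.d (k - 1) k ≫ g0) (by simp) (by rw [e, Category.assoc, hg0, h1])
    have hx := hQ _ (hproj (n - 1 - 1)) (k - 1) g1 hg1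
    obtain ⟨g3, hg3⟩ : ∃ g3 : P.X k ⟶ X.X (n - 1 - 1), P.d (k - 1) k ≫ g3 = g1 := by
      have e' : k - 1 + 1 = k := by omega
      rw [e'] at hx
      exact hx
    refine ⟨g0 - g3 ≫ X.d _ _, ?_, ?_⟩
    · rw [Preadditive.comp_sub, ← Category.assoc, hg3, hg1', sub_self]
    · simp [hg0]

/-- Every acyclic bounded below complex of projective
`A`-modules is GP-acyclic. -/
theorem boundedBelow_acyclic_projective_GPAcyclic (X : Cplx A)
    (hb : BoundedBelow A X) (hacyc : IsAcyclicComplex A X)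
    (hproj : ∀ n : ℤ, Module.Projective A (X.X n)) :
    GPAcyclic A X := by
  rintro G ⟨P, hPa, hP, hQ, ⟨e⟩⟩ n f hf
  obtain ⟨a, ha⟩ := hb
  have hex := (P.exactAt_iff' (-1) 0 1 (by simp) (by simp)).1 (hPa 0)
  rw [ShortComplex.exact_iff_epi_kernel_lift] at hex
  let p : P.X (-1) ⟶ kernel (P.d 0 1) := kernel.lift (P.d 0 1) (P.d (-1) 0) (by simp)
  have hp : Epi p := hex
  have hpi : p ≫ kernel.ι (P.d 0 1) = P.d (-1) 0 := kernel.lift_ι _ _ _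
  have hpz : P.d (-1 - 1) (-1) ≫ p = 0 := by
    rw [← cancel_mono (kernel.ι (P.d 0 1)), Category.assoc, hpi]
    simp
  obtain ⟨g, hg1, hg2⟩ := gp_lift_aux A P X hP hQ hacyc hproj a ha (n + 1 - a).toNat n
    (by omega) (-1) (p ≫ e.inv ≫ f) (by rw [← Category.assoc, hpz, zero_comp])
    (by simp [hf])
  obtain ⟨g', hg'⟩ := hQ _ (hproj (n - 1)) (-1) g hg1
  change P.X 0 ⟶ _ at g'
  change P.d (-1) 0 ≫ g' = g at hg'
  refine ⟨e.hom ≫ kernel.ι _ ≫ g', ?_⟩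
  rw [← cancel_epi e.inv, ← cancel_epi p, ← hg2, ← hg', ← hpi]
  simp
end

section
/- Let A be a ring, and let P be an acyclic bounded below cochain complex of projective A-modules. Then P is contractible if and only if all its cocycles ker(dⁿ_P) are Gorenstein-projective A-modules. -/
open CategoryTheory CategoryTheory.Limits

universe u

variable (A : Type u) [Ring A]

lemma gp_split {G P Z : ModuleCat.{u} A} (hG : IsGorensteinProjective A G)
    (hZ : Module.Projective A Z) (i : Z ⟶ P) (p : P ⟶ G) [Mono i] [Epi p]
    (hip : i ≫ p = 0)
    (hl : ∀ {W : ModuleCat.{u} A} (w : W ⟶ P), w ≫ p = 0 → ∃ w', w' ≫ i = w) :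
    ∃ s : G ⟶ P, s ≫ p = 𝟙 G := by
  obtain ⟨T, hT, hTp, hTQ, ⟨e⟩⟩ := hG
  have : Projective (T.X (-1)) := (IsProjective.iff_projective _).1 (hTp (-1))
  have hex0 : (ShortComplex.mk (T.d (-1) 0) (T.d 0 1) (by simp)).Exact :=
    (T.exactAt_iff' (-1) 0 1 (by simp) (by simp)).1 (hT 0)
  have hex1 : (ShortComplex.mk (T.d (-2) (-1)) (T.d (-1) 0) (by simp)).Exact :=
    (T.exactAt_iff' (-2) (-1) 0 (by simp) (by simp)).1 (hT (-1))
  let q : T.X (-1) ⟶ kernel (T.d 0 1) := kernel.lift _ (T.d (-1) 0) (by simp)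
  have : Epi q := hex0.epi_kernelLift
  have hqι : q ≫ kernel.ι _ = T.d (-1) 0 := kernel.lift_ι _ _ _
  have hdq : T.d (-2) (-1) ≫ q = 0 := by
    rw [← cancel_mono (kernel.ι _), Category.assoc, hqι]; simp
  have hexq : (ShortComplex.mk (T.d (-2) (-1)) q hdq).Exact := by
    let φ : ShortComplex.mk (T.d (-2) (-1)) q hdq ⟶
        ShortComplex.mk (T.d (-2) (-1)) (T.d (-1) 0) (by simp) :=
      { τ₁ := 𝟙 _, τ₂ := 𝟙 _, τ₃ := kernel.ι _, comm₁₂ := by simp, comm₂₃ := by simp [hqι] }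
    have : Epi φ.τ₁ := by dsimp [φ]; infer_instance
    have : IsIso φ.τ₂ := by dsimp [φ]; infer_instance
    have : Mono φ.τ₃ := by dsimp [φ]; infer_instance
    exact (ShortComplex.exact_iff_of_epi_of_isIso_of_mono φ).2 hex1
  let φ : T.X (-1) ⟶ P := Projective.factorThru (q ≫ e.inv) p
  have hφ : φ ≫ p = q ≫ e.inv := Projective.factorThru_comp _ _
  obtain ⟨ψ, hψ⟩ := hl (T.d (-2) (-1) ≫ φ) (by
    rw [Category.assoc, hφ, reassoc_of% hdq, zero_comp])
  obtain ⟨χ, hχ⟩ := hTQ Z hZ (-2) ψ (by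
    rw [← cancel_mono i, Category.assoc, hψ]; simp)
  change T.X (-1) ⟶ Z at χ
  change T.d (-2) (-1) ≫ χ = ψ at hχ
  have hk : T.d (-2) (-1) ≫ (φ - χ ≫ i) = 0 := by
    rw [Preadditive.comp_sub, reassoc_of% hχ, hψ, sub_self]
  have : Epi (ShortComplex.mk (T.d (-2) (-1)) q hdq).g := ‹Epi q›
  have hd : q ≫ hexq.desc (φ - χ ≫ i) hk = φ - χ ≫ i := hexq.g_desc _ hk
  refine ⟨e.hom ≫ hexq.desc (φ - χ ≫ i) hk, ?_⟩
  have : hexq.desc (φ - χ ≫ i) hk ≫ p = e.inv := by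
    rw [← cancel_epi q, reassoc_of% hd, Preadditive.sub_comp, Category.assoc, hip, comp_zero,
      sub_zero, hφ]
  rw [Category.assoc, this, e.hom_inv_id]

/-- the map to cocycles -/
noncomputable def toCocyc (P : Cplx A) (i j : ℤ) : P.X i ⟶ kernel (P.d j (j + 1)) :=
  kernel.lift _ (P.d i j) (by simp)

lemma toCocyc_ι (P : Cplx A) (i j : ℤ) : toCocyc A P i j ≫ kernel.ι _ = P.d i j :=
  kernel.lift_ι _ _ _

lemma ι_toCocyc (P : Cplx A) (i j : ℤ) (h : i + 1 = j) :
    kernel.ι (P.d i (i + 1)) ≫ toCocyc A P i j = 0 := by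
  subst h
  rw [← cancel_mono (kernel.ι _), Category.assoc, toCocyc_ι]; simp

lemma epi_toCocyc (P : Cplx A) (hP : IsAcyclicComplex A P) (i j : ℤ) (h : i + 1 = j) :
    Epi (toCocyc A P i j) := by
  have hex0 : (ShortComplex.mk (P.d i j) (P.d j (j + 1)) (by simp)).Exact :=
    (P.exactAt_iff' i j (j + 1) (by simp; omega) (by simp)).1 (hP j)
  exact hex0.epi_kernelLift

lemma proj_cocycles (P : Cplx A)
    (hb : BoundedBelow A P) (hacyc : IsAcyclicComplex A P)
    (hproj : ∀ n : ℤ, Module.Projective A (P.X n))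
    (h : ∀ n : ℤ, IsGorensteinProjective A (kernel (P.d n (n + 1)))) (n : ℤ) :
    Projective (kernel (P.d n (n + 1))) := by
  obtain ⟨a, ha⟩ := hb
  have key : ∀ k : ℕ, ∀ n < a + k, Projective (kernel (P.d n (n + 1))) := by
    intro k
    induction k with
    | zero =>
      intro n hn
      have : IsZero (kernel (P.d n (n + 1))) :=
        IsZero.of_mono (kernel.ι _) (ha n (by simpa using hn))
      exact this.projective
    | succ k ih =>
      intro n hn
      obtain ⟨m, rfl⟩ : ∃ m, n = m + 1 := ⟨n - 1, by ring⟩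
      have hm := ih m (by push_cast at hn; omega)
      have := epi_toCocyc A P hacyc m (m + 1) rfl
      obtain ⟨s, hs⟩ := gp_split A (h (m + 1)) ((IsProjective.iff_projective _).2 hm)
        (kernel.ι (P.d m (m + 1))) (toCocyc A P m (m + 1)) (ι_toCocyc A P m _ rfl) (by
          intro W w hw
          refine ⟨kernel.lift _ w ?_, kernel.lift_ι _ _ _⟩
          rw [← toCocyc_ι, reassoc_of% hw, zero_comp])
      have : Projective (P.X m) := (IsProjective.iff_projective _).1 (hproj m)
      exact Retract.projective ⟨s, _, hs⟩
  exact key (n + 1 - a).toNat n (by omega)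

lemma contractible_of_T (P : Cplx A) (hacyc : IsAcyclicComplex A P)
    (T : ∀ i j : ℤ, P.X i ⟶ P.X j)
    (hT : ∀ i j, j + 1 = i → P.d j i ≫ T i j ≫ P.d j i = P.d j i)
    (hT' : ∀ i j, j + 1 = i → kernel.ι (P.d i (i + 1)) ≫ T i j ≫ P.d j i = kernel.ι _) :
    Contractible A P := by
  refine ⟨⟨fun i j => if j + 1 = i then (𝟙 _ - P.d i (i + 1) ≫ T (i + 1) i) ≫ T i j else 0,
    ?_, ?_⟩⟩
  · intro i j hij
    exact if_neg (by simpa using hij)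
  · intro i
    rw [dNext_eq (i' := i + 1) _ (by simp), prevD_eq (j' := i - 1) _ (by simp),
      if_pos rfl, if_pos (by ring)]
    have h1 : (𝟙 _ - P.d i (i + 1) ≫ T (i + 1) i) ≫ P.d i (i + 1) = 0 := by
      rw [Preadditive.sub_comp, Category.assoc, hT _ _ rfl]; simp
    have h2 : (𝟙 _ - P.d i (i + 1) ≫ T (i + 1) i) ≫ T i (i - 1) ≫ P.d (i - 1) i
        = 𝟙 _ - P.d i (i + 1) ≫ T (i + 1) i := by
      have := congrArg (kernel.lift _ _ h1 ≫ ·) (hT' i (i - 1) (by ring))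
      simpa only [kernel.lift_ι_assoc, kernel.lift_ι] using this
    rw [Category.assoc, h2]
    simp

lemma contractible_of_proj (P : Cplx A) (hacyc : IsAcyclicComplex A P)
    (h : ∀ n : ℤ, Projective (kernel (P.d n (n + 1)))) : Contractible A P := by
  have hs : ∀ i j : ℤ, ∃ s : kernel (P.d i (i + 1)) ⟶ P.X j,
      j + 1 = i → s ≫ toCocyc A P j i = 𝟙 _ := by
    intro i j
    by_cases hij : j + 1 = i
    · have := epi_toCocyc A P hacyc j i hij
      exact ⟨Projective.factorThru (𝟙 _) (toCocyc A P j i), fun _ => Projective.factorThru_comp _ _⟩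
    · exact ⟨0, fun h => absurd h hij⟩
  choose s hs using hs
  have hr0 : ∀ i, (𝟙 _ - toCocyc A P i (i + 1) ≫ s (i + 1) i) ≫ P.d i (i + 1) = 0 := by
    intro i
    rw [← toCocyc_ι A P i (i + 1), ← Category.assoc, Preadditive.sub_comp, Category.assoc, hs _ _ rfl]; simp
  let r : ∀ i, P.X i ⟶ kernel (P.d i (i + 1)) := fun i => kernel.lift _ _ (hr0 i)
  have hr : ∀ i, kernel.ι _ ≫ r i = 𝟙 _ := by
    intro i
    rw [← cancel_mono (kernel.ι _), Category.assoc, kernel.lift_ι, Preadditive.comp_sub,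
      ← Category.assoc _ (toCocyc _ _ _ _), ι_toCocyc A P i _ rfl]
    simp
  have hT' : ∀ i j, j + 1 = i →
      kernel.ι (P.d i (i + 1)) ≫ (r i ≫ s i j) ≫ P.d j i = kernel.ι _ := by
    intro i j hij
    rw [← toCocyc_ι A P j i, Category.assoc, reassoc_of% (hr i), reassoc_of% (hs i j hij)]
  refine contractible_of_T A P hacyc (fun i j => r i ≫ s i j) ?_ hT'
  intro i j hij
  have := congrArg (toCocyc A P j i ≫ ·) (hT' i j hij)
  simpa only [← Category.assoc, toCocyc_ι] using this

/-- reindexing of a complex -/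
def reidx (P : Cplx A) (n : ℤ) : Cplx A where
  X i := P.X (n + i)
  d i j := P.d (n + i) (n + j)
  shape i j h := P.shape _ _ (by simp at h ⊢; omega)
  d_comp_d' _ _ _ _ _ := P.d_comp_d _ _ _

lemma gp_of_contractible (P : Cplx A) (hacyc : IsAcyclicComplex A P)
    (hproj : ∀ n : ℤ, Module.Projective A (P.X n)) (hc : Contractible A P) (n : ℤ) :
    IsGorensteinProjective A (kernel (P.d n (n + 1))) := by
  refine ⟨reidx A P n, ?_, fun i => hproj _, ?_, ?_⟩
  · intro i
    rw [HomologicalComplex.exactAt_iff' _ (i - 1) i (i + 1) (by simp) (by simp)]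
    exact (P.exactAt_iff' (n + (i - 1)) (n + i) (n + (i + 1)) (by simp; omega)
      (by simp; omega)).1 (hacyc _)
  · intro Q _ i f hf
    obtain ⟨H⟩ := hc
    change P.X (n + i) ⟶ Q at f
    change P.d (n + (i - 1)) (n + i) ≫ f = 0 at hf
    refine ⟨H.hom (n + (i + 1)) (n + i) ≫ f, ?_⟩
    change P.d (n + i) (n + (i + 1)) ≫ H.hom (n + (i + 1)) (n + i) ≫ f = f
    have := H.comm (n + i)
    rw [dNext_eq (i' := n + (i + 1)) _ (by simp; omega),
      prevD_eq (j' := n + (i - 1)) _ (by simp; omega)] at this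
    have := congrArg (· ≫ f) this
    simp [hf] at this
    exact this.symm
  · have : ∀ m, m = n → Nonempty (kernel (P.d n (n + 1)) ≅ kernel (P.d m (n + 1))) := by
      rintro m rfl
      exact ⟨Iso.refl _⟩
    exact this (n + 0) (by simp)

/-- An acyclic bounded below complex of projective `A`-modules
is contractible iff all its cocycles `ker(dⁿ)` are Gorenstein-projective. -/
theorem boundedBelow_acyclic_projective_contractible_iff (P : Cplx A)
    (hb : BoundedBelow A P) (hacyc : IsAcyclicComplex A P)
    (hproj : ∀ n : ℤ, Module.Projective A (P.X n)) :
    Contractible A P ↔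
      ∀ n : ℤ, IsGorensteinProjective A (kernel (P.d n (n + 1))) :=
  ⟨fun hc n => gp_of_contractible A P hacyc hproj hc n,
    fun h => contractible_of_proj A P hacyc (proj_cocycles A P hb hacyc hproj h)⟩
end
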